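/- arXiv:1705.07991 — 7 statements merged into one kernel-verified Lean document; each statement's English description precedes it below -/
import Mathlib

section
/- Suppose the Kalman rank condition holds: span{H₀ᵏ b : 0 ≤ k ≤ n−1} = ℝⁿ. Then for every m ∈ ℕ, every T > 0 and every η > 0 there exists δ > 0 such that for all x*, x† ∈ ℝⁿ with |x*| + |x†| ≤ δ there exists a trajectory (x,u) of ẋ = f(x,u) on [0,T] with u ∈ Cᵐ([0,T],ℝ), u compactly supported in the open interval (0,T), ‖u‖_{Cᵐ(0,T)} ≤ η, x(0) = x* and x(T) = x†. -/
open MeasureTheory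

noncomputable section

/-- `ℝⁿ` with its Euclidean structure. -/
abbrev Euc (n : ℕ) := EuclideanSpace ℝ (Fin n)

/-- A trajectory of the control system `ẋ = f(x,u)` on `[0,T]`:
`x` is continuous on `[0,T]`, `u` is measurable (is in `L^∞`), and the integral
equation `x(t) = x(0) + ∫₀ᵗ f(x(s),u(s)) ds` holds on `[0,T]`. -/
def IsTrajectory {n : ℕ} (f : Euc n → ℝ → Euc n) (T : ℝ)
    (x : ℝ → Euc n) (u : ℝ → ℝ) : Prop :=
  ContinuousOn x (Set.Icc 0 T) ∧ Measurable u ∧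
    ∀ t ∈ Set.Icc (0:ℝ) T, x t = x 0 + ∫ s in (0:ℝ)..t, f (x s) (u s)

/-- `H₀ := ∂ₓ f(0,0)`. -/
def H0 {n : ℕ} (f : Euc n → ℝ → Euc n) : Euc n →L[ℝ] Euc n :=
  fderiv ℝ (fun x => f x 0) 0

/-- `b := ∂ᵤ f(0,0)`. -/
def bctrl {n : ℕ} (f : Euc n → ℝ → Euc n) : Euc n := deriv (f 0) 0

open Filter Topology Set
open scoped ContDiff

section Prelim

variable {V W : Type*} [NormedAddCommGroup V] [NormedSpace ℝ V]
  [NormedAddCommGroup W] [NormedSpace ℝ W]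

/-- Composition with a map that is strictly differentiable at `c` is strictly differentiable,
as a map between spaces of continuous functions, at the constant function `c`. -/
theorem hasStrictFDerivAt_continuousMap_comp_const {K : Type*} [TopologicalSpace K]
    [CompactSpace K] (g : C(V, W)) {g' : V →L[ℝ] W} {c : V} (hg : HasStrictFDerivAt g g' c) :
    HasStrictFDerivAt (fun x : C(K, V) => g.comp x) (g'.compLeftContinuous ℝ K)
      (ContinuousMap.const K c) := by
  refine .of_isLittleO (Asymptotics.isLittleO_iff.2 fun ε hε => ?_)
  have h := Asymptotics.isLittleO_iff.1 hg.isLittleO hε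
  obtain ⟨r, hr, hball⟩ := Metric.eventually_nhds_iff.1 h
  refine Metric.eventually_nhds_iff.2 ⟨r, hr, fun p hp => ?_⟩
  refine (ContinuousMap.norm_le _ (by positivity)).2 fun t => ?_
  have hpt : dist (p.1 t, p.2 t) (c, c) < r := by
    refine lt_of_le_of_lt ?_ hp
    exact max_le_max (ContinuousMap.dist_apply_le_dist (f := p.1) (g := ContinuousMap.const K c) t)
      (ContinuousMap.dist_apply_le_dist (f := p.2) (g := ContinuousMap.const K c) t)
  refine (hball hpt).trans ?_
  gcongr
  exact ContinuousMap.norm_coe_le_norm (p.1 - p.2) t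

/-- The integration operator `y ↦ (t ↦ ∫₀ᵗ y)` on `C([0,T], V)`. -/
def volterra (V : Type*) [NormedAddCommGroup V] [NormedSpace ℝ V] {T : ℝ} (hT : 0 ≤ T) :
    C(Icc (0:ℝ) T, V) →L[ℝ] C(Icc (0:ℝ) T, V) :=
  LinearMap.mkContinuous
    { toFun := fun y => ⟨fun t => ∫ s in (0:ℝ)..t, IccExtend hT y s,
        (intervalIntegral.continuous_primitive
          (fun _ _ => (y.continuous.Icc_extend' (h := hT)).intervalIntegrable _ _) 0).comp
          continuous_subtype_val⟩
      map_add' := fun y z => by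
        ext t
        exact intervalIntegral.integral_add
          ((y.continuous.Icc_extend' (h := hT)).intervalIntegrable _ _)
          ((z.continuous.Icc_extend' (h := hT)).intervalIntegrable _ _)
      map_smul' := fun c y => by
        ext t
        exact intervalIntegral.integral_smul c _ }
    T fun y => by
      refine (ContinuousMap.norm_le _ (by positivity)).2 fun t => ?_
      refine (intervalIntegral.norm_integral_le_of_norm_le_const (C := ‖y‖) fun s _ =>
        ContinuousMap.norm_coe_le_norm y _).trans ?_
      rw [sub_zero, abs_of_nonneg t.2.1, mul_comm]
      gcongr
      exact t.2.2

theorem volterra_apply {T : ℝ} (hT : 0 ≤ T) (y : C(Icc (0:ℝ) T, V)) (t : Icc (0:ℝ) T) :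
    volterra V hT y t = ∫ s in (0:ℝ)..t, IccExtend hT y s := rfl

theorem intervalIntegral_eq_integral_of_tsupport_subset {T : ℝ} {φ : ℝ → ℝ}
    (hφ : tsupport φ ⊆ Ioo 0 T) (g : ℝ → V) :
    ∫ s in (0:ℝ)..T, φ s • g s = ∫ s, φ s • g s :=
  intervalIntegral.integral_eq_integral_of_support_subset
    ((Function.support_smul_subset_left _ _).trans
      ((subset_tsupport φ).trans (hφ.trans Ioo_subset_Ioc_self)))

variable [CompleteSpace V]

theorem exp_smul_mul_exp_smul_neg (H : V →L[ℝ] V) (t : ℝ) :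
    NormedSpace.exp (t • H) * NormedSpace.exp (t • (-H)) = 1 := by
  let := NormedAlgebra.restrictScalars ℚ ℝ (V →L[ℝ] V)
  rw [← NormedSpace.exp_add_of_commute]
  · simp
  · rw [smul_neg]
    exact (Commute.refl _).neg_right

theorem exp_smul_neg_mul_exp_smul (H : V →L[ℝ] V) (t : ℝ) :
    NormedSpace.exp (t • (-H)) * NormedSpace.exp (t • H) = 1 := by
  simpa using exp_smul_mul_exp_smul_neg (-H) t

theorem continuous_exp_smul (H : V →L[ℝ] V) :
    Continuous fun t : ℝ => NormedSpace.exp (t • H) :=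
  continuous_iff_continuousAt.2 fun t => (hasDerivAt_exp_smul_const H t).continuousAt

/-- The solution of `ẏ = H y + r`, `y(0) = 0`, by variation of constants. -/
def duhamel (H : V →L[ℝ] V) (r : ℝ → V) (t : ℝ) : V :=
  NormedSpace.exp (t • H) (∫ s in (0:ℝ)..t, NormedSpace.exp (s • (-H)) (r s))

theorem hasDerivAt_duhamel (H : V →L[ℝ] V) {r : ℝ → V} (hr : Continuous r) (t : ℝ) :
    HasDerivAt (duhamel H r) (H (duhamel H r t) + r t) t := by
  have hc : Continuous fun s => NormedSpace.exp (s • (-H)) (r s) :=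
    (continuous_exp_smul (-H)).clm_apply hr
  have h := (hasDerivAt_exp_smul_const' H t).clm_apply (hc.integral_hasStrictDerivAt 0 t).hasDerivAt
  have := congrArg (fun A : V →L[ℝ] V => A (r t)) (exp_smul_mul_exp_smul_neg H t)
  simp only [mul_apply_eq_comp, one_apply_eq_self] at this
  rw [this] at h
  exact h

theorem duhamel_eq_integral (H : V →L[ℝ] V) {r : ℝ → V} (hr : Continuous r) (t : ℝ) :
    duhamel H r t = ∫ s in (0:ℝ)..t, (H (duhamel H r s) + r s) := by
  have hc : Continuous (duhamel H r) :=
    continuous_iff_continuousAt.2 fun t => (hasDerivAt_duhamel H hr t).continuousAt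
  rw [intervalIntegral.integral_eq_sub_of_hasDerivAt (fun s _ => hasDerivAt_duhamel H hr s)
    (((H.continuous.comp hc).add hr).intervalIntegrable _ _)]
  simp [duhamel]

/-- A functional vanishing along `s ↦ exp(-sH) b` on an interval vanishes on all
`exp(-sH) Hᵏ b`. -/
theorem dual_exp_smul_neg_pow_eq_zero {H : V →L[ℝ] V} {b : V} {U : Set ℝ} (hU : IsOpen U)
    (l : V →L[ℝ] ℝ) (hl : ∀ s ∈ U, l (NormedSpace.exp (s • (-H)) b) = 0) (k : ℕ) :
    ∀ s ∈ U, l (NormedSpace.exp (s • (-H)) ((H ^ k) b)) = 0 := by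
  induction k with
  | zero => simpa using hl
  | succ k ih =>
    intro s hs
    have h1 : HasDerivAt (fun s : ℝ => l (NormedSpace.exp (s • (-H)) ((H ^ k) b)))
        (l ((NormedSpace.exp (s • (-H)) * (-H)) ((H ^ k) b))) s := by
      have := (hasDerivAt_exp_smul_const (-H) s).clm_apply (hasDerivAt_const s ((H ^ k) b))
      rw [map_zero, add_zero] at this
      exact l.hasFDerivAt.comp_hasDerivAt s this
    have h2 : HasDerivAt (fun s : ℝ => l (NormedSpace.exp (s • (-H)) ((H ^ k) b))) 0 s :=
      (hasDerivAt_const s (0:ℝ)).congr_of_eventuallyEq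
        (eventually_of_mem (hU.mem_nhds hs) ih)
    have h3 := h1.unique h2
    rw [pow_succ']
    simpa [mul_apply_eq_comp] using h3

end Prelim

/-- Controllability of the linear system `(H, b)` by smooth compactly supported controls. -/
theorem exists_contDiff_integral_smul_exp_eq {V : Type*} [NormedAddCommGroup V] [NormedSpace ℝ V]
    [FiniteDimensional ℝ V] {H : V →L[ℝ] V} {b : V}
    (hspan : Submodule.span ℝ (range fun k : ℕ => (H ^ k) b) = ⊤) {T : ℝ} (hT : 0 < T) (v : V) :
    ∃ φ : ℝ → ℝ, ContDiff ℝ ∞ φ ∧ tsupport φ ⊆ Ioo 0 T ∧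
      ∫ s in (0:ℝ)..T, φ s • NormedSpace.exp (s • (-H)) b = v := by
  have : CompleteSpace V := FiniteDimensional.complete ℝ V
  have hc : Continuous fun s : ℝ => NormedSpace.exp (s • (-H)) b :=
    (continuous_exp_smul (-H)).clm_apply continuous_const
  let S : Submodule ℝ V :=
    { carrier := {v | ∃ φ : ℝ → ℝ, ContDiff ℝ ∞ φ ∧ tsupport φ ⊆ Ioo 0 T ∧
        ∫ s in (0:ℝ)..T, φ s • NormedSpace.exp (s • (-H)) b = v}
      zero_mem' := ⟨0, contDiff_const, by simp, by simp⟩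
      add_mem' := by
        rintro _ _ ⟨φ, hφ, hφs, rfl⟩ ⟨ψ, hψ, hψs, rfl⟩
        refine ⟨φ + ψ, hφ.add hψ, (tsupport_add φ ψ).trans (union_subset hφs hψs), ?_⟩
        simp only [Pi.add_apply, add_smul]
        exact intervalIntegral.integral_add ((hφ.continuous.smul hc).intervalIntegrable _ _)
          ((hψ.continuous.smul hc).intervalIntegrable _ _)
      smul_mem' := by
        rintro c _ ⟨φ, hφ, hφs, rfl⟩
        refine ⟨c • φ, hφ.const_smul c, (tsupport_smul_subset_right (fun _ => c) φ).trans hφs, ?_⟩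
        simp only [Pi.smul_apply, smul_assoc]
        exact intervalIntegral.integral_smul c _ }
  suffices hS : S = ⊤ by
    have : v ∈ S := hS ▸ Submodule.mem_top
    exact this
  by_contra hS
  obtain ⟨l₀, hl₀, hker⟩ := S.exists_le_ker_of_lt_top (lt_top_iff_ne_top.2 hS)
  let l : V →L[ℝ] ℝ := l₀.toContinuousLinearMap
  have hae := isOpen_Ioo.ae_eq_zero_of_integral_contDiff_smul_eq_zero (U := Ioo 0 T)
    (f := fun s : ℝ => l (NormedSpace.exp (s • (-H)) b)) (μ := volume)
    ((l.continuous.comp hc).locallyIntegrable.locallyIntegrableOn _) fun φ hφ _ hφs => by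
      have hmem : ∫ s in (0:ℝ)..T, φ s • NormedSpace.exp (s • (-H)) b ∈ S := ⟨φ, hφ, hφs, rfl⟩
      have h0 : l (∫ s in (0:ℝ)..T, φ s • NormedSpace.exp (s • (-H)) b) = 0 := hker hmem
      have hcomm := l.intervalIntegral_comp_comm (μ := volume)
        (f := fun s => φ s • NormedSpace.exp (s • (-H)) b)
        ((hφ.continuous.smul hc).intervalIntegrable 0 T)
      rw [← intervalIntegral_eq_integral_of_tsupport_subset hφs]
      simpa only [map_smul, h0] using hcomm
  have hzero : ∀ s ∈ Ioo 0 T, l (NormedSpace.exp (s • (-H)) b) = 0 :=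
    Measure.eqOn_open_of_ae_eq (g := 0) (μ := volume)
      ((ae_restrict_iff' measurableSet_Ioo).2 hae) isOpen_Ioo
      (l.continuous.comp hc).continuousOn continuousOn_const
  have hpow := dual_exp_smul_neg_pow_eq_zero isOpen_Ioo l hzero
  have hs : T / 2 ∈ Ioo 0 T := ⟨by positivity, by linarith⟩
  have hcomp : (l ∘L NormedSpace.exp ((T / 2) • (-H))).toLinearMap = 0 :=
    LinearMap.ext_on_range hspan fun k => hpow k _ hs
  refine hl₀ (LinearMap.ext fun x => ?_)
  have hx := congrArg (fun A => A (NormedSpace.exp ((T / 2) • H) x)) hcomp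
  have hinv := congrArg (fun A : V →L[ℝ] V => A x) (exp_smul_neg_mul_exp_smul H (T / 2))
  simp only [mul_apply_eq_comp, one_apply_eq_self] at hinv
  simp only [ContinuousLinearMap.coe_coe, ContinuousLinearMap.comp_apply, hinv] at hx
  exact hx

/-- A finite family of smooth compactly supported functions has derivatives up to order `m`
that are uniformly bounded. -/
theorem exists_forall_abs_iteratedDeriv_le {ι : Type*} [Fintype ι] {φ : ι → ℝ → ℝ}
    (hφ : ∀ j, ContDiff ℝ ∞ (φ j)) (m : ℕ) (T : ℝ) :
    ∃ C : ℝ, ∀ j, ∀ i ≤ m, ∀ t ∈ Icc (0:ℝ) T, |iteratedDeriv i (φ j) t| ≤ C := by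
  have h : ∀ (j : ι) (i : ℕ), ∃ C : ℝ, ∀ t ∈ Icc (0:ℝ) T, ‖iteratedDeriv i (φ j) t‖ ≤ C :=
    fun j i => isCompact_Icc.exists_bound_of_continuousOn
      ((hφ j).continuous_iteratedDeriv i (by exact_mod_cast le_top)).continuousOn
  choose C hC using h
  refine ⟨∑ j, ∑ i ∈ Finset.range (m + 1), |C j i|, fun j i hi t ht => ?_⟩
  calc |iteratedDeriv i (φ j) t| ≤ |C j i| := (hC j i t ht).trans (le_abs_self _)
    _ ≤ ∑ i ∈ Finset.range (m + 1), |C j i| :=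
      Finset.single_le_sum (f := fun i => |C j i|) (fun _ _ => abs_nonneg _)
        (Finset.mem_range.2 (by omega))
    _ ≤ _ := Finset.single_le_sum (f := fun j => ∑ i ∈ Finset.range (m + 1), |C j i|)
        (fun _ _ => by positivity) (Finset.mem_univ j)

theorem fderiv_uncurry_apply {n : ℕ} {f : Euc n → ℝ → Euc n}
    (hf : DifferentiableAt ℝ (fun p : Euc n × ℝ => f p.1 p.2) (0, 0)) (y : Euc n) (c : ℝ) :
    fderiv ℝ (fun p : Euc n × ℝ => f p.1 p.2) (0, 0) (y, c) = H0 f y + c • bctrl f := by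
  have h1 : HasFDerivAt (fun x => f x 0)
      ((fderiv ℝ (fun p : Euc n × ℝ => f p.1 p.2) (0, 0)).comp
        (ContinuousLinearMap.inl ℝ (Euc n) ℝ)) 0 :=
    HasFDerivAt.comp (f := fun x : Euc n => (x, (0 : ℝ))) (0 : Euc n) hf.hasFDerivAt
      (hasFDerivAt_prodMk_left (0 : Euc n) (0 : ℝ))
  have h2 : HasDerivAt (f 0)
      (fderiv ℝ (fun p : Euc n × ℝ => f p.1 p.2) (0, 0) ((0 : Euc n), (1 : ℝ))) 0 := by
    have := HasFDerivAt.comp (f := fun u : ℝ => ((0 : Euc n), u)) (0 : ℝ) hf.hasFDerivAt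
      (hasFDerivAt_prodMk_right (0 : Euc n) (0 : ℝ))
    have h3 := this.hasDerivAt
    rw [ContinuousLinearMap.comp_apply, ContinuousLinearMap.inr_apply] at h3
    exact h3
  rw [H0, bctrl, h1.fderiv, h2.deriv, ← map_smul]
  simp [← map_add]

/-- The linear map `(x, a) ↦ (t ↦ (x t, ∑ j, a j * φ j t))`. -/
def stateControl (V : Type*) [NormedAddCommGroup V] [NormedSpace ℝ V] {K ι : Type*}
    [TopologicalSpace K] [CompactSpace K] [Fintype ι] (φ : ι → C(K, ℝ)) :
    C(K, V) × (ι → ℝ) →L[ℝ] C(K, V × ℝ) :=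
  (ContinuousLinearMap.inl ℝ V ℝ).compLeftContinuous ℝ K ∘L ContinuousLinearMap.fst ℝ _ _ +
    ∑ j, (ContinuousLinearMap.proj j ∘L ContinuousLinearMap.snd ℝ C(K, V) (ι → ℝ)).smulRight
      ((ContinuousLinearMap.inr ℝ V ℝ).compLeftContinuous ℝ K (φ j))

theorem stateControl_apply {V : Type*} [NormedAddCommGroup V] [NormedSpace ℝ V] {K ι : Type*}
    [TopologicalSpace K] [CompactSpace K] [Fintype ι] (φ : ι → C(K, ℝ))
    (p : C(K, V) × (ι → ℝ)) (t : K) :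
    stateControl V φ p t = (p.1 t, ∑ j, p.2 j * φ j t) := by
  simp [stateControl, ContinuousMap.sum_apply, Prod.ext_iff, Prod.fst_sum, Prod.snd_sum]

/-- If the Kalman rank condition `span{H₀ᵏ b : 0 ≤ k ≤ n-1} = ℝⁿ` holds, then the
system `ẋ = f(x,u)` is smoothly small-time locally controllable, with controls
compactly supported in the interior of the time interval. -/
theorem statement0
    (n : ℕ) (hn : 0 < n) (f : Euc n → ℝ → Euc n)
    (hf : ContDiff ℝ (⊤ : ℕ∞) (fun p : Euc n × ℝ => f p.1 p.2))
    (hf0 : f 0 0 = 0)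
    (hKalman : Submodule.span ℝ
      (Set.range fun k : Fin n => ((H0 f) ^ (k : ℕ)) (bctrl f)) = ⊤) :
    ∀ m : ℕ, ∀ T > (0:ℝ), ∀ η > (0:ℝ), ∃ δ > (0:ℝ),
      ∀ xs xd : Euc n, ‖xs‖ + ‖xd‖ ≤ δ →
        ∃ (x : ℝ → Euc n) (u : ℝ → ℝ),
          IsTrajectory f T x u ∧
          ContDiff ℝ m u ∧
          tsupport u ⊆ Set.Ioo 0 T ∧
          (∀ i ≤ m, ∀ t ∈ Set.Icc (0:ℝ) T, |iteratedDeriv i u t| ≤ η) ∧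
          x 0 = xs ∧ x T = xd := by
  intro m T hT η hη
  have hspan : Submodule.span ℝ (range fun k : ℕ => ((H0 f) ^ k) (bctrl f)) = ⊤ := by
    rw [eq_top_iff, ← hKalman]
    exact Submodule.span_mono (range_subset_iff.2 fun k => ⟨(k : ℕ), rfl⟩)
  let e := (EuclideanSpace.basisFun (Fin n) ℝ).toBasis
  choose φ hφ hφs hφe using fun j => exists_contDiff_integral_smul_exp_eq hspan hT (e j)
  obtain ⟨C, hC⟩ := exists_forall_abs_iteratedDeriv_le hφ m T
  let uc : (Fin n → ℝ) → ℝ → ℝ := fun a t => ∑ j, a j * φ j t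
  have huc : ∀ a, ContDiff ℝ ∞ (uc a) := fun a =>
    ContDiff.sum fun j _ => contDiff_const.mul (hφ j)
  let φ' : Fin n → C(Icc (0:ℝ) T, ℝ) := fun j => ⟨fun t => φ j t, (hφ j).continuous.comp
    continuous_subtype_val⟩
  let F : C(Euc n × ℝ, Euc n) := ⟨fun p => f p.1 p.2, hf.continuous⟩
  let F' := fderiv ℝ (fun p : Euc n × ℝ => f p.1 p.2) (0, 0)
  have hF : HasStrictFDerivAt F F' (0, 0) :=
    hf.contDiffAt.hasStrictFDerivAt (by simp)
  have hF' : ∀ y c, F' (y, c) = H0 f y + c • bctrl f :=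
    fderiv_uncurry_apply hF.hasFDerivAt.differentiableAt
  let L := stateControl (Euc n) φ'
  let J := volterra (Euc n) hT.le
  let tT : Icc (0:ℝ) T := ⟨T, hT.le, le_rfl⟩
  -- the map whose fibre over `(x*, x†)` consists of the trajectories joining `x*` to `x†`
  let G : C(Icc (0:ℝ) T, Euc n) × (Fin n → ℝ) → C(Icc (0:ℝ) T, Euc n) × Euc n := fun p =>
    (p.1 - J (F.comp (L p)), p.1 tT)
  let G' : C(Icc (0:ℝ) T, Euc n) × (Fin n → ℝ) →L[ℝ] C(Icc (0:ℝ) T, Euc n) × Euc n :=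
    (ContinuousLinearMap.fst ℝ _ _ - J ∘L F'.compLeftContinuous ℝ _ ∘L L).prod
      (ContinuousMap.evalCLM ℝ tT ∘L ContinuousLinearMap.fst ℝ _ _)
  have hG : HasStrictFDerivAt G G' 0 := by
    have h0 : ContinuousMap.const (Icc (0:ℝ) T) ((0 : Euc n), (0:ℝ)) = L 0 := by
      rw [map_zero]; rfl
    have h1 := hasStrictFDerivAt_continuousMap_comp_const (K := Icc (0:ℝ) T) F hF
    rw [h0] at h1
    have h2 : HasStrictFDerivAt (fun p : C(Icc (0:ℝ) T, Euc n) × (Fin n → ℝ) => p.1 tT)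
        (ContinuousMap.evalCLM ℝ tT ∘L ContinuousLinearMap.fst ℝ _ _) 0 :=
      (ContinuousMap.evalCLM ℝ tT ∘L ContinuousLinearMap.fst ℝ C(Icc (0:ℝ) T, Euc n)
        (Fin n → ℝ)).hasStrictFDerivAt
    exact (hasStrictFDerivAt_fst.sub
      (J.hasStrictFDerivAt.comp _ (h1.comp _ L.hasStrictFDerivAt))).prodMk h2
  have hsurj : G'.toLinearMap.range = ⊤ := by
    refine LinearMap.range_eq_top.2 ?_
    rintro ⟨g, z⟩
    let H := H0 f
    let gE : ℝ → Euc n := IccExtend hT.le g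
    have hgE : Continuous gE := g.continuous.Icc_extend'
    have hexp : Continuous fun s : ℝ => NormedSpace.exp (s • (-H)) := continuous_exp_smul (-H)
    let v := NormedSpace.exp (T • (-H)) (z - g tT) -
      ∫ s in (0:ℝ)..T, NormedSpace.exp (s • (-H)) (H (gE s))
    let a : Fin n → ℝ := fun j => e.repr v j
    have ha : ∫ s in (0:ℝ)..T, uc a s • NormedSpace.exp (s • (-H)) (bctrl f) = v := by
      rw [← e.sum_repr v]
      simp only [uc, Finset.sum_smul, mul_smul]
      have hcont : ∀ j, Continuous fun s => a j • φ j s • NormedSpace.exp (s • (-H)) (bctrl f) :=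
        fun j => ((hφ j).continuous.smul (hexp.clm_apply continuous_const)).const_smul (a j)
      rw [intervalIntegral.integral_finsetSum fun j _ => (hcont j).intervalIntegrable _ _]
      refine Finset.sum_congr rfl fun j _ => ?_
      rw [intervalIntegral.integral_smul, hφe j]
    let r : ℝ → Euc n := fun s => H (gE s) + uc a s • bctrl f
    have hr : Continuous r :=
      (H.continuous.comp hgE).add ((huc a).continuous.smul continuous_const)
    have hwc : Continuous (duhamel H r) :=
      continuous_iff_continuousAt.2 fun t => (hasDerivAt_duhamel H hr t).continuousAt
    have hwT : duhamel H r T = z - g tT := by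
      have hint : ∫ s in (0:ℝ)..T, NormedSpace.exp (s • (-H)) (r s) =
          NormedSpace.exp (T • (-H)) (z - g tT) := by
        simp only [r, map_add, map_smul]
        have hc1 : Continuous fun s => NormedSpace.exp (s • (-H)) (H (gE s)) :=
          hexp.clm_apply (H.continuous.comp hgE)
        have hc2 : Continuous fun s => uc a s • NormedSpace.exp (s • (-H)) (bctrl f) :=
          (huc a).continuous.smul (hexp.clm_apply continuous_const)
        rw [intervalIntegral.integral_add (hc1.intervalIntegrable _ _)
          (hc2.intervalIntegrable _ _), ha]
        exact add_sub_cancel _ _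
      rw [duhamel, hint]
      exact congrArg (fun A : Euc n →L[ℝ] Euc n => A (z - g tT)) (exp_smul_mul_exp_smul_neg H T)
    let w : C(Icc (0:ℝ) T, Euc n) := ⟨fun t => duhamel H r t, hwc.comp continuous_subtype_val⟩
    refine ⟨(g + w, a), Prod.ext ?_ ?_⟩
    · ext1 t
      change (g t + duhamel H r t) - J (F'.compLeftContinuous ℝ _ (L (g + w, a))) t = g t
      have hJ : J (F'.compLeftContinuous ℝ _ (L (g + w, a))) t = duhamel H r t := by
        rw [duhamel_eq_integral H hr, volterra_apply]
        refine intervalIntegral.integral_congr fun s hs => ?_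
        rw [uIcc_of_le t.2.1] at hs
        have hsT : s ∈ Icc (0:ℝ) T := ⟨hs.1, hs.2.trans t.2.2⟩
        have hg : gE s = g ⟨s, hsT⟩ := IccExtend_of_mem hT.le g hsT
        simp only [IccExtend_of_mem hT.le _ hsT]
        change F' (L (g + w, a) ⟨s, hsT⟩) = _
        rw [stateControl_apply, hF']
        simp only [r, hg, ContinuousMap.add_apply, map_add]
        change H (g ⟨s, hsT⟩) + H (duhamel H r s) + uc a s • bctrl f = _
        abel
      rw [hJ, add_sub_cancel_right]
    · change g tT + duhamel H r T = z
      rw [hwT, add_sub_cancel]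
  have hmap := hG.map_nhds_eq_of_surj hsurj
  have hG0 : G 0 = 0 := by
    have : F.comp (L 0) = 0 := by
      ext1 t
      rw [ContinuousMap.comp_apply, map_zero]
      exact hf0
    change ((0 : C(Icc (0:ℝ) T, Euc n)) - J (F.comp (L 0)), (0 : Euc n)) = 0
    rw [this, map_zero, sub_zero]
    rfl
  rw [hG0] at hmap
  -- parameters giving small controls
  have hsmall : ∀ᶠ p : C(Icc (0:ℝ) T, Euc n) × (Fin n → ℝ) in 𝓝 0, (∑ j, |p.2 j|) * C ≤ η := by
    have hc : Continuous fun p : C(Icc (0:ℝ) T, Euc n) × (Fin n → ℝ) => (∑ j, |p.2 j|) * C := by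
      fun_prop
    have := hc.tendsto 0
    simp only [Prod.snd_zero, Pi.zero_apply, abs_zero, Finset.sum_const_zero, zero_mul] at this
    exact this.eventually_le_const hη
  have himg := Filter.image_mem_map (m := G) hsmall
  rw [hmap] at himg
  obtain ⟨r, hr, hball⟩ := Metric.mem_nhds_iff.1 himg
  refine ⟨r / 2, by positivity, fun xs xd hx => ?_⟩
  have hmem : (ContinuousMap.const (Icc (0:ℝ) T) xs, xd) ∈ Metric.ball
      (0 : C(Icc (0:ℝ) T, Euc n) × Euc n) r := by
    have h1 : ‖ContinuousMap.const (Icc (0:ℝ) T) xs‖ ≤ ‖xs‖ :=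
      (ContinuousMap.norm_le _ (norm_nonneg _)).2 fun _ => le_rfl
    rw [mem_ball_zero_iff, Prod.norm_def, max_lt_iff]
    constructor <;> dsimp only <;> linarith [norm_nonneg xs, norm_nonneg xd]
  obtain ⟨⟨x, a⟩, hxa, hGx⟩ := hball hmem
  have hxeq : ∀ t, x t = xs + J (F.comp (L (x, a))) t := fun t => by
    have := congrArg (fun q => q.1 t) hGx
    exact sub_eq_iff_eq_add.1 this
  have hxT : x tT = xd := congrArg Prod.snd hGx
  have hint : ∀ t ∈ Icc (0:ℝ) T, IccExtend hT.le x t =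
      xs + ∫ s in (0:ℝ)..t, f (IccExtend hT.le x s) (uc a s) := fun t ht => by
    rw [IccExtend_of_mem hT.le _ ht, hxeq, volterra_apply]
    congr 1
    refine intervalIntegral.integral_congr fun s hs => ?_
    rw [uIcc_of_le ht.1] at hs
    have hsT : s ∈ Icc (0:ℝ) T := ⟨hs.1, hs.2.trans ht.2⟩
    simp only [IccExtend_of_mem hT.le _ hsT]
    change F (L (x, a) ⟨s, hsT⟩) = _
    rw [stateControl_apply]
    rfl
  have hx0 : IccExtend hT.le x 0 = xs := by
    rw [hint 0 ⟨le_rfl, hT.le⟩]; simp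
  refine ⟨IccExtend hT.le x, uc a, ⟨x.continuous.Icc_extend'.continuousOn,
    (huc a).continuous.measurable, fun t ht => by rw [hx0, hint t ht]⟩,
    (huc a).of_le (by exact_mod_cast le_top), ?_, fun i hi t ht => ?_, hx0, ?_⟩
  · have hcl : IsClosed (⋃ j, tsupport (φ j)) :=
      isClosed_iUnion_of_finite fun j => isClosed_tsupport _
    refine (closure_minimal (fun t ht => ?_) hcl).trans (iUnion_subset hφs)
    obtain ⟨j, -, hj⟩ := Finset.exists_ne_zero_of_sum_ne_zero ht
    exact mem_iUnion.2 ⟨j, subset_tsupport _ (right_ne_zero_of_mul hj)⟩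
  · have hd : iteratedDeriv i (uc a) t = ∑ j, a j * iteratedDeriv i (φ j) t := by
      simp only [uc]
      rw [iteratedDeriv_fun_sum fun j _ =>
        (contDiff_const.mul ((hφ j).of_le (by exact_mod_cast le_top))).contDiffAt]
      simp only [iteratedDeriv_const_mul_field]
    rw [hd]
    refine le_trans ?_ hxa
    rw [Finset.sum_mul]
    refine (Finset.abs_sum_le_sum_abs _ _).trans (Finset.sum_le_sum fun j _ => ?_)
    rw [abs_mul]
    gcongr
    exact hC j i hi t ht
  · rw [IccExtend_of_mem hT.le _ ⟨hT.le, le_rfl⟩]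
    exact hxT
end
end

section
/- Consider the system on ℝ³: ẋ₁ = u, ẋ₂ = x₁, ẋ₃ = x₁² − x₂². Let 0 < T ≤ π and let (x,u) ∈ C⁰([0,T],ℝ³) × L¹((0,T),ℝ) be a trajectory with x₂(0) = x₂(T) = 0. Then x₃(T) − x₃(0) ≥ ((π/T)² − 1) ∫₀ᵀ x₂(t)² dt ≥ 0. In particular, for T ≤ π the system is not locally controllable in time T: e.g. no trajectory with x(0) = 0 reaches a state x(T) with x₂(T) = 0 and x₃(T) < 0. -/
open MeasureTheory

noncomputable section

/-- A trajectory of the control-affine system `ẋ₁ = u, ẋ₂ = x₁, ẋ₃ = x₁² − x₂²`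
on `[0,T]` with control `u ∈ L¹((0,T),ℝ)`: `x : [0,T] → ℝ³` is continuous and the
corresponding integral equations hold. Components are indexed `0, 1, 2`. -/
def IsTrajBrockett (T : ℝ) (x : ℝ → EuclideanSpace ℝ (Fin 3)) (u : ℝ → ℝ) : Prop :=
  ContinuousOn x (Set.Icc 0 T) ∧ IntervalIntegrable u volume 0 T ∧
    ∀ t ∈ Set.Icc (0:ℝ) T,
      x t 0 = x 0 0 + ∫ s in (0:ℝ)..t, u s ∧
      x t 1 = x 0 1 + ∫ s in (0:ℝ)..t, x s 0 ∧
      x t 2 = x 0 2 + ∫ s in (0:ℝ)..t, ((x s 0)^2 - (x s 1)^2)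

/-- Subcritical Wirtinger inequality: the comparison function `-k tan (k (t - T/2))` solves the
Riccati equation `w' = -(k² + w²)` and is smooth on `[0,T]` as long as `k T < π`. -/
theorem sq_mul_integral_sq_le_of_mul_lt_pi {T k : ℝ} (hT : 0 < T) (hk : 0 < k)
    (hkT : k * T < Real.pi) {a y : ℝ → ℝ} (ha : ContinuousOn a (Set.Icc 0 T))
    (hy : ContinuousOn y (Set.Icc 0 T)) (hder : ∀ t ∈ Set.Ioo 0 T, HasDerivAt y (a t) t)
    (h0 : y 0 = 0) (h1 : y T = 0) :
    k ^ 2 * (∫ t in (0:ℝ)..T, y t ^ 2) ≤ ∫ t in (0:ℝ)..T, a t ^ 2 := by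
  have hcos : ∀ t ∈ Set.Icc 0 T, Real.cos (k * (t - T / 2)) ≠ 0 := fun t ht =>
    (Real.cos_pos_of_mem_Ioo ⟨by nlinarith [ht.1], by nlinarith [ht.2]⟩).ne'
  have hw : ∀ t ∈ Set.Icc 0 T, HasDerivAt (fun t => -k * Real.tan (k * (t - T / 2)))
      (-(k ^ 2 + (-k * Real.tan (k * (t - T / 2))) ^ 2)) t := by
    intro t ht
    have hlin : HasDerivAt (fun t => k * (t - T / 2)) (k * 1) t :=
      ((hasDerivAt_id t).sub_const _).const_mul k
    refine (((Real.hasDerivAt_tan (hcos t ht)).comp t hlin).const_mul (-k)).congr_deriv ?_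
    rw [Real.tan_eq_sin_div_cos]
    have hc := hcos t ht
    generalize k * (t - T / 2) = θ at hc ⊢
    field_simp
    linear_combination Real.sin_sq_add_cos_sq θ
  have hwc : ContinuousOn (fun t => -k * Real.tan (k * (t - T / 2))) (Set.Icc 0 T) :=
    fun t ht => (hw t ht).continuousAt.continuousWithinAt
  have hac := ha.pow 2
  have hyc := hy.pow 2
  have key := intervalIntegral.sub_le_integral_of_hasDeriv_right_of_le hT.le (hwc.mul hyc)
    (fun t ht => ((hw t (Set.Ioo_subset_Icc_self ht)).mul
      ((hder t ht).pow 2)).hasDerivWithinAt)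
    (hac.sub (hyc.const_mul (k ^ 2))).integrableOn_Icc
    (fun t _ => by
      simp only [Pi.pow_apply, Pi.sub_apply]
      norm_num
      nlinarith [sq_nonneg (a t - (-k * Real.tan (k * (t - T / 2))) * y t)])
  have hia : IntervalIntegrable (fun t => a t ^ 2) volume 0 T :=
    hac.intervalIntegrable_of_Icc hT.le
  have hiy : IntervalIntegrable (fun t => y t ^ 2) volume 0 T :=
    hyc.intervalIntegrable_of_Icc hT.le
  have hsplit := intervalIntegral.integral_sub hia (hiy.const_mul (k ^ 2))
  rw [intervalIntegral.integral_const_mul] at hsplit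
  simp only [Pi.mul_apply, Pi.pow_apply, Pi.sub_apply, h0, h1] at key
  rw [hsplit] at key
  linarith

/-- Wirtinger's inequality on `[0,T]` with Dirichlet boundary conditions. -/
theorem pi_div_sq_mul_integral_sq_le {T : ℝ} (hT : 0 < T) {a y : ℝ → ℝ}
    (ha : ContinuousOn a (Set.Icc 0 T)) (hy : ContinuousOn y (Set.Icc 0 T))
    (hder : ∀ t ∈ Set.Ioo 0 T, HasDerivAt y (a t) t) (h0 : y 0 = 0) (h1 : y T = 0) :
    (Real.pi / T) ^ 2 * (∫ t in (0:ℝ)..T, y t ^ 2) ≤ ∫ t in (0:ℝ)..T, a t ^ 2 := by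
  have hpos : 0 < Real.pi / T := div_pos Real.pi_pos hT
  have hlim : Filter.Tendsto (fun k : ℝ => k ^ 2 * (∫ t in (0:ℝ)..T, y t ^ 2))
      (nhdsWithin (Real.pi / T) (Set.Iio (Real.pi / T)))
      (nhds ((Real.pi / T) ^ 2 * (∫ t in (0:ℝ)..T, y t ^ 2))) :=
    Continuous.continuousWithinAt (by fun_prop)
  refine le_of_tendsto hlim ?_
  filter_upwards [Ioo_mem_nhdsLT hpos] with k hk
  exact sq_mul_integral_sq_le_of_mul_lt_pi hT hk.1 ((lt_div_iff₀ hT).1 hk.2) ha hy hder h0 h1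

/-- For `0 < T ≤ π`, any trajectory of `ẋ₁ = u, ẋ₂ = x₁, ẋ₃ = x₁² − x₂²` with
`x₂(0) = x₂(T) = 0` satisfies `x₃(T) − x₃(0) ≥ ((π/T)² − 1)∫₀ᵀ x₂² ≥ 0`; in
particular the system is not locally controllable in time `T ≤ π`. -/
theorem statement7
    (T : ℝ) (hT0 : 0 < T) (hTpi : T ≤ Real.pi)
    (x : ℝ → EuclideanSpace ℝ (Fin 3)) (u : ℝ → ℝ)
    (hx : IsTrajBrockett T x u)
    (h20 : x 0 1 = 0) (h2T : x T 1 = 0) :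
    ((Real.pi / T)^2 - 1) * (∫ t in (0:ℝ)..T, (x t 1)^2) ≤ x T 2 - x 0 2 ∧
    0 ≤ ((Real.pi / T)^2 - 1) * (∫ t in (0:ℝ)..T, (x t 1)^2) := by
  obtain ⟨hc, -, h⟩ := hx
  have hcoord (i : Fin 3) : ContinuousOn (fun t => x t i) (Set.Icc 0 T) := by fun_prop
  have hder : ∀ t ∈ Set.Ioo 0 T, HasDerivAt (fun t => x t 1) (x t 0) t := by
    intro t ht
    have hint : IntervalIntegrable (fun s => x s 0) volume 0 t :=
      ((hcoord 0).mono (Set.Icc_subset_Icc_right ht.2.le)).intervalIntegrable_of_Icc ht.1.le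
    have hprim := (intervalIntegral.integral_hasDerivAt_right hint
      (((hcoord 0).mono Set.Ioo_subset_Icc_self).stronglyMeasurableAtFilter isOpen_Ioo t ht)
      ((hcoord 0).continuousAt (Icc_mem_nhds ht.1 ht.2))).const_add (x 0 1)
    refine hprim.congr_of_eventuallyEq ?_
    filter_upwards [Icc_mem_nhds ht.1 ht.2] with s hs using (h s hs).2.1
  have hwirt := pi_div_sq_mul_integral_sq_le hT0 (hcoord 0) (hcoord 1) hder h20 h2T
  have hx2 := (h T ⟨hT0.le, le_rfl⟩).2.2
  have hsq (i : Fin 3) : IntervalIntegrable (fun t => x t i ^ 2) volume 0 T :=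
    ((hcoord i).pow 2).intervalIntegrable_of_Icc hT0.le
  rw [intervalIntegral.integral_sub (hsq 0) (hsq 1)] at hx2
  refine ⟨by linarith, mul_nonneg ?_
    (intervalIntegral.integral_nonneg hT0.le fun t _ => sq_nonneg _)⟩
  exact sub_nonneg.2 (one_le_pow₀ ((one_le_div hT0).2 hTpi))
end
end

section
/- Consider the system on ℝ³: ẋ₁ = u, ẋ₂ = x₁, ẋ₃ = x₁² − x₂². For every T > π the system is smoothly locally controllable in time T: for every m ∈ ℕ and every η > 0 there exists δ > 0 such that for all x*, x† ∈ ℝ³ with |x*| + |x†| ≤ δ there exists a trajectory (x,u) on [0,T] with u ∈ C^∞([0,T],ℝ), ‖u‖_{Cᵐ(0,T)} ≤ η, x(0) = x* and x(T) = x†. -/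
open MeasureTheory

noncomputable section

/-- Small linear combinations of three smooth functions are uniformly `Cᵐ`-small on a
compact interval. -/
lemma exists_iteratedDeriv_linearCombination_le {f g h : ℝ → ℝ}
    (hf : ContDiff ℝ (⊤ : ℕ∞) f) (hg : ContDiff ℝ (⊤ : ℕ∞) g) (hh : ContDiff ℝ (⊤ : ℕ∞) h)
    (T : ℝ) (m : ℕ) {η : ℝ} (hη : 0 < η) :
    ∃ ε > (0 : ℝ), ∀ a b c : ℝ, |a| ≤ ε → |b| ≤ ε → |c| ≤ ε →
      ∀ i ≤ m, ∀ t ∈ Set.Icc (0 : ℝ) T,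
        |iteratedDeriv i (fun s => a * f s + b * g s + c * h s) t| ≤ η := by
  have hcont : ∀ {k : ℝ → ℝ}, ContDiff ℝ (⊤ : ℕ∞) k → ∀ i : ℕ,
      Continuous (iteratedDeriv i k) := fun hk i =>
    hk.continuous_iteratedDeriv i (by exact_mod_cast le_top)
  let F : ℝ → ℝ := fun t => ∑ i ∈ Finset.range (m + 1),
    (|iteratedDeriv i f t| + |iteratedDeriv i g t| + |iteratedDeriv i h t|)
  have hF : Continuous F := continuous_finsetSum _ fun i _ =>
    (((hcont hf i).abs.add (hcont hg i).abs).add (hcont hh i).abs)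
  obtain ⟨M, hM⟩ := (isCompact_Icc (a := (0 : ℝ)) (b := T)).bddAbove_image hF.continuousOn
  have hM' : 0 < max M 1 := lt_max_of_lt_right one_pos
  refine ⟨η / max M 1, by positivity, fun a b c ha hb hc i hi t ht => ?_⟩
  have hFt : F t ≤ max M 1 := (hM ⟨t, ht, rfl⟩).trans (le_max_left _ _)
  have hterm : |iteratedDeriv i f t| + |iteratedDeriv i g t| + |iteratedDeriv i h t| ≤ F t :=
    Finset.single_le_sum
      (f := fun i => |iteratedDeriv i f t| + |iteratedDeriv i g t| + |iteratedDeriv i h t|)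
      (fun j _ => by positivity) (Finset.mem_range.2 (by omega))
  have hat : ∀ {k : ℝ → ℝ}, ContDiff ℝ (⊤ : ℕ∞) k → ContDiffAt ℝ i k t := fun hk =>
    (hk.of_le (by exact_mod_cast le_top)).contDiffAt
  have haf : ContDiffAt ℝ i (fun s => a * f s) t := contDiffAt_const.mul (hat hf)
  have hbg : ContDiffAt ℝ i (fun s => b * g s) t := contDiffAt_const.mul (hat hg)
  have hch : ContDiffAt ℝ i (fun s => c * h s) t := contDiffAt_const.mul (hat hh)
  rw [iteratedDeriv_fun_add (haf.add hbg) hch, iteratedDeriv_fun_add haf hbg,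
    iteratedDeriv_const_mul_field, iteratedDeriv_const_mul_field, iteratedDeriv_const_mul_field]
  calc _ ≤ |a| * |iteratedDeriv i f t| + |b| * |iteratedDeriv i g t|
        + |c| * |iteratedDeriv i h t| := by
        simpa only [abs_mul] using abs_add_three (a * iteratedDeriv i f t)
          (b * iteratedDeriv i g t) (c * iteratedDeriv i h t)
    _ ≤ η / max M 1 * |iteratedDeriv i f t| + η / max M 1 * |iteratedDeriv i g t|
        + η / max M 1 * |iteratedDeriv i h t| := by gcongr
    _ = η / max M 1 *
        (|iteratedDeriv i f t| + |iteratedDeriv i g t| + |iteratedDeriv i h t|) := by ring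
    _ ≤ η / max M 1 * max M 1 := by gcongr; exact hterm.trans hFt
    _ = η := by field_simp

/-- A smooth function vanishing to second order at `0` and `T` is a valid variation of `x₂`. -/
structure IsVariation (T : ℝ) (ψ : ℝ → ℝ) : Prop where
  contDiff : ContDiff ℝ (⊤ : ℕ∞) ψ
  zero_left : ψ 0 = 0
  deriv_left : deriv ψ 0 = 0
  zero_right : ψ T = 0
  deriv_right : deriv ψ T = 0

lemma exists_isVariation_pos {T : ℝ} (hT : 0 < T) :
    ∃ ψ, IsVariation T ψ ∧ 0 < ∫ t in (0 : ℝ)..T, (deriv ψ t ^ 2 - ψ t ^ 2) := by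
  obtain ⟨N, hN⟩ := exists_nat_gt (max T 1)
  have hNT : T < N := (le_max_left _ _).trans_lt hN
  have hN1 : 1 < (N : ℝ) := (le_max_right _ _).trans_lt hN
  set κ : ℝ := N * (2 * Real.pi) / T with hκ
  have hκT : κ * T = N * (2 * Real.pi) := by rw [hκ]; field_simp
  have hκ2 : 3 < κ ^ 2 := by
    have : 6 < κ := by
      rw [hκ, lt_div_iff₀ hT]; nlinarith [Real.pi_gt_three]
    nlinarith
  have hκ0 : κ ≠ 0 := by rintro h; rw [h] at hκ2; norm_num at hκ2
  have hcos : Real.cos (κ * T) = 1 := by rw [hκT, Real.cos_nat_mul_two_pi]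
  have hsin : Real.sin (κ * T) = 0 := by
    rw [hκT, show (N : ℝ) * (2 * Real.pi) = ((2 * N : ℕ) : ℝ) * Real.pi by push_cast; ring,
      Real.sin_nat_mul_pi]
  have hd : ∀ t, HasDerivAt (fun t => 1 - Real.cos (κ * t)) (κ * Real.sin (κ * t)) t := by
    intro t
    have := (((hasDerivAt_id t).const_mul κ).cos).const_sub 1
    refine this.congr_deriv ?_
    simp; ring
  have hderiv : deriv (fun t => 1 - Real.cos (κ * t)) = fun t => κ * Real.sin (κ * t) :=
    funext fun t => (hd t).deriv
  refine ⟨fun t => 1 - Real.cos (κ * t), ⟨by fun_prop, by simp, by simp [hderiv],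
    by simp [hcos], by simp [hderiv, hsin]⟩, ?_⟩
  let G : ℝ → ℝ := fun t => (κ ^ 2 - 3) / 2 * t + 2 * (Real.sin (κ * t) / κ)
      - (κ ^ 2 + 1) / 2 * (Real.sin (κ * t) * Real.cos (κ * t) / κ)
  have hG : ∀ t, HasDerivAt G ((κ * Real.sin (κ * t)) ^ 2 - (1 - Real.cos (κ * t)) ^ 2) t := by
    intro t
    have hl : HasDerivAt (fun t => κ * t) κ t := by
      simpa using (hasDerivAt_id t).const_mul κ
    have := (((hasDerivAt_id t).const_mul ((κ ^ 2 - 3) / 2)).add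
      ((hl.sin.div_const κ).const_mul 2)).sub
      (((hl.sin.mul hl.cos).div_const κ).const_mul ((κ ^ 2 + 1) / 2))
    refine this.congr_deriv ?_
    field_simp
    linear_combination (1 - κ ^ 2) * Real.sin_sq_add_cos_sq (κ * t)
  rw [hderiv, intervalIntegral.integral_eq_sub_of_hasDerivAt (f := G) (fun t _ => hG t)
    (Continuous.intervalIntegrable (by fun_prop) _ _)]
  simp only [G, hsin]
  simp only [mul_zero, Real.sin_zero, zero_mul, zero_div, add_zero, sub_zero]
  nlinarith

open Filter Topology in
lemma exists_isVariation_neg {T : ℝ} (hT : Real.pi < T) :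
    ∃ ψ, IsVariation T ψ ∧ ∫ t in (0 : ℝ)..T, (deriv ψ t ^ 2 - ψ t ^ 2) < 0 := by
  have hpi := Real.pi_pos
  have hT0 : 0 < T := hpi.trans hT
  set ω : ℝ := Real.pi / T with hω
  have hω0 : 0 < ω := by positivity
  have hω1 : ω < 1 := (div_lt_one hT0).2 hT
  have hωT : ω * T = Real.pi := by rw [hω]; field_simp
  let s : ℝ → ℝ := fun t => Real.sin (ω * t)
  have hs : Continuous s := by fun_prop
  let r : ℝ → ℝ → ℝ := fun ε t => s t ^ 2 / (s t ^ 2 + ε)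
  let ψ : ℝ → ℝ → ℝ := fun ε t => s t * r ε t
  let ψ' : ℝ → ℝ → ℝ := fun ε t => ω * Real.cos (ω * t) * (3 * r ε t - 2 * r ε t ^ 2)
  have hr : ∀ ε > 0, Continuous (r ε) := fun ε hε =>
    (hs.pow 2).div₀ ((hs.pow 2).add continuous_const) fun t => by positivity
  have hr01 : ∀ ε > 0, ∀ t, 0 ≤ r ε t ∧ r ε t ≤ 1 := fun ε hε t =>
    ⟨by positivity, (div_le_one (by positivity)).2 (by linarith)⟩
  have hd : ∀ ε > 0, ∀ t, HasDerivAt (ψ ε) (ψ' ε t) t := by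
    intro ε hε t
    have hl : HasDerivAt s (Real.cos (ω * t) * ω) t := by
      simpa using ((hasDerivAt_id t).const_mul ω).sin
    have h0 : s t ^ 2 + ε ≠ 0 := by positivity
    have := hl.mul ((hl.pow 2).div ((hl.pow 2).add_const ε) h0)
    refine this.congr_deriv ?_
    simp only [ψ', r, Pi.pow_apply, Pi.div_apply]
    field_simp
    push_cast
    ring
  have hderiv : ∀ ε > 0, deriv (ψ ε) = ψ' ε := fun ε hε => funext fun t => (hd ε hε t).deriv
  have hvar : ∀ ε > 0, IsVariation T (ψ ε) := by
    intro ε hε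
    have hss : ContDiff ℝ (⊤ : ℕ∞) s := by fun_prop
    have hs0 : s 0 = 0 := by simp [s]
    have hsT : s T = 0 := by simp [s, hωT]
    exact ⟨hss.mul ((hss.pow 2).div ((hss.pow 2).add contDiff_const) fun t => by positivity),
      by simp [ψ, hs0], by simp [hderiv ε hε, ψ', r, hs0], by simp [ψ, hsT],
      by simp [hderiv ε hε, ψ', r, hsT]⟩
  have hlim : Tendsto (fun ε => ∫ t in (0 : ℝ)..T, (ψ' ε t ^ 2 - ψ ε t ^ 2)) (𝓝[>] 0)
      (𝓝 (∫ t in (0 : ℝ)..T, ((ω * Real.cos (ω * t)) ^ 2 - s t ^ 2))) := by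
    refine intervalIntegral.tendsto_integral_filter_of_dominated_convergence (fun _ => 10)
      ?_ ?_ intervalIntegrable_const ?_
    · filter_upwards [self_mem_nhdsWithin] with ε hε
      have := hr ε hε
      exact Continuous.aestronglyMeasurable (by fun_prop)
    · filter_upwards [self_mem_nhdsWithin] with ε hε
      refine Eventually.of_forall fun t _ => ?_
      obtain ⟨h0, h1⟩ := hr01 ε hε t
      have hc := Real.sin_sq_add_cos_sq (ω * t)
      have h2 : (ω * Real.cos (ω * t)) ^ 2 ≤ 1 := by
        rw [mul_pow]
        exact mul_le_one₀ (by nlinarith) (sq_nonneg _) (Real.cos_sq_le_one _)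
      have h3 : (3 * r ε t - 2 * r ε t ^ 2) ^ 2 ≤ 9 := by
        rw [show (9 : ℝ) = 3 ^ 2 by norm_num]
        exact pow_le_pow_left₀ (by nlinarith) (by nlinarith) 2
      have h4 : s t ^ 2 ≤ 1 := Real.sin_sq_le_one _
      have h5 : r ε t ^ 2 ≤ 1 := by nlinarith
      have h6 : ψ' ε t ^ 2 ≤ 9 := by
        simp only [ψ']
        rw [mul_pow]
        nlinarith [sq_nonneg (ω * Real.cos (ω * t)), sq_nonneg (3 * r ε t - 2 * r ε t ^ 2)]
      have h7 : ψ ε t ^ 2 ≤ 1 := by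
        simp only [ψ]
        rw [mul_pow]
        exact mul_le_one₀ h4 (sq_nonneg _) h5
      rw [Real.norm_eq_abs, abs_le]
      constructor <;> nlinarith [sq_nonneg (ψ' ε t), sq_nonneg (ψ ε t)]
    · have hne : ∀ᵐ t : ℝ, t ≠ T := by simp [ae_iff]
      filter_upwards [hne] with t htT ht
      rw [Set.uIoc_of_le hT0.le] at ht
      have hst : 0 < s t := Real.sin_pos_of_pos_of_lt_pi (mul_pos hω0 ht.1)
        (hωT ▸ mul_lt_mul_of_pos_left (lt_of_le_of_ne ht.2 htT) hω0)
      have hrt : Tendsto (fun ε => r ε t) (𝓝[>] 0) (𝓝 1) := by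
        have : ContinuousAt (fun ε => r ε t) 0 :=
          continuousAt_const.div (by fun_prop) (by positivity)
        have h1 : r 0 t = 1 := by simp [r, hst.ne']
        simpa only [h1] using this.tendsto.mono_left nhdsWithin_le_nhds
      have h1 : Tendsto (fun ε => ψ' ε t) (𝓝[>] 0) (𝓝 (ω * Real.cos (ω * t))) := by
        have := ((hrt.const_mul 3).sub ((hrt.pow 2).const_mul 2)).const_mul
          (ω * Real.cos (ω * t))
        convert this using 2
        norm_num
      have h2 : Tendsto (fun ε => ψ ε t) (𝓝[>] 0) (𝓝 (s t)) := by
        simpa using hrt.const_mul (s t)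
      exact (h1.pow 2).sub (h2.pow 2)
  have hval : ∫ t in (0 : ℝ)..T, ((ω * Real.cos (ω * t)) ^ 2 - s t ^ 2)
      = (ω ^ 2 - 1) / 2 * T := by
    let G : ℝ → ℝ := fun t => (ω ^ 2 - 1) / 2 * t
      + (ω ^ 2 + 1) / 2 * (Real.sin (ω * t) * Real.cos (ω * t) / ω)
    have hG : ∀ t, HasDerivAt G ((ω * Real.cos (ω * t)) ^ 2 - s t ^ 2) t := by
      intro t
      have hl : HasDerivAt (fun t => ω * t) ω t := by
        simpa using (hasDerivAt_id t).const_mul ω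
      have := ((hasDerivAt_id t).const_mul ((ω ^ 2 - 1) / 2)).add
        (((hl.sin.mul hl.cos).div_const ω).const_mul ((ω ^ 2 + 1) / 2))
      refine this.congr_deriv ?_
      simp only [s]
      field_simp
      linear_combination (1 - ω ^ 2) * Real.sin_sq_add_cos_sq (ω * t)
    rw [intervalIntegral.integral_eq_sub_of_hasDerivAt (f := G) (fun t _ => hG t)
      (Continuous.intervalIntegrable (by fun_prop) _ _)]
    simp [G, hωT]
  have hneg : (ω ^ 2 - 1) / 2 * T < 0 := mul_neg_of_neg_of_pos (by nlinarith) hT0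
  rw [hval] at hlim
  obtain ⟨ε, hε, hε0⟩ := ((hlim.eventually (gt_mem_nhds hneg)).and self_mem_nhdsWithin).exists
  exact ⟨ψ ε, hvar ε hε0, by rwa [hderiv ε hε0]⟩

/-- The trajectory whose second component is a given smooth function. -/
lemma isTrajBrockett_of_hasDerivAt {φ φ' φ'' : ℝ → ℝ} (T c : ℝ)
    (h1 : ∀ t, HasDerivAt φ (φ' t) t) (h2 : ∀ t, HasDerivAt φ' (φ'' t) t)
    (h3 : Continuous φ'') :
    IsTrajBrockett T
      (fun t => !₂[φ' t, φ t, c + ∫ s in (0 : ℝ)..t, (φ' s ^ 2 - φ s ^ 2)]) φ'' := by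
  have hφ : Continuous φ := continuous_iff_continuousAt.2 fun t => (h1 t).continuousAt
  have hφ' : Continuous φ' := continuous_iff_continuousAt.2 fun t => (h2 t).continuousAt
  have hQ : Continuous fun t => ∫ s in (0 : ℝ)..t, (φ' s ^ 2 - φ s ^ 2) :=
    intervalIntegral.continuous_primitive
      (fun a b => ((hφ'.pow 2).sub (hφ.pow 2)).intervalIntegrable a b) 0
  refine ⟨?_, h3.intervalIntegrable _ _, fun t _ => ⟨?_, ?_, ?_⟩⟩
  · refine Continuous.continuousOn ?_
    refine (PiLp.continuous_toLp 2 _).comp (continuous_pi fun i => ?_)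
    fin_cases i
    · exact hφ'
    · exact hφ
    · exact continuous_const.add hQ
  · have := intervalIntegral.integral_eq_sub_of_hasDerivAt (fun s _ => h2 s)
      (h3.intervalIntegrable 0 t)
    simp [this]
  · have := intervalIntegral.integral_eq_sub_of_hasDerivAt (fun s _ => h1 s)
      (hφ'.intervalIntegrable 0 t)
    simp [this]
  · simp

/-- The small root of a quadratic equation whose leading coefficient and right-hand side have
compatible signs. -/
lemma quadratic_root {q b c : ℝ} (hq : q ≠ 0) (h : 0 ≤ q * c) :
    2 * ((-b + √(b ^ 2 + q * c)) / q) * b + ((-b + √(b ^ 2 + q * c)) / q) ^ 2 * q = c := by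
  have hs : √(b ^ 2 + q * c) ^ 2 = b ^ 2 + q * c := Real.sq_sqrt (by positivity)
  field_simp
  linear_combination hs

/-- The coefficient of `t²` in the cubic interpolating position `x 1` and velocity `x 0` of both
end points. -/
def hermiteQuad (T : ℝ) (z : EuclideanSpace ℝ (Fin 3) × EuclideanSpace ℝ (Fin 3)) : ℝ :=
  (3 * (z.2 1 - z.1 1) - (2 * z.1 0 + z.2 0) * T) / T ^ 2

/-- The coefficient of `t³` in the cubic interpolating position `x 1` and velocity `x 0` of both
end points. -/
def hermiteCub (T : ℝ) (z : EuclideanSpace ℝ (Fin 3) × EuclideanSpace ℝ (Fin 3)) : ℝ :=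
  (-2 * (z.2 1 - z.1 1) + (z.1 0 + z.2 0) * T) / T ^ 3

/-- The cubic interpolating position `x 1` and velocity `x 0` of both end points. -/
def hermite (T : ℝ) (z : EuclideanSpace ℝ (Fin 3) × EuclideanSpace ℝ (Fin 3)) (t : ℝ) : ℝ :=
  z.1 1 + z.1 0 * t + hermiteQuad T z * t ^ 2 + hermiteCub T z * t ^ 3

/-- The derivative of the interpolating cubic `hermite`. -/
def hermiteDeriv (T : ℝ) (z : EuclideanSpace ℝ (Fin 3) × EuclideanSpace ℝ (Fin 3)) (t : ℝ) : ℝ :=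
  z.1 0 + hermiteQuad T z * (2 * t) + hermiteCub T z * (3 * t ^ 2)

/-- The variation of `x₃` along the trajectory given by the interpolating cubic. -/
def hermiteEnergy (T : ℝ) (z : EuclideanSpace ℝ (Fin 3) × EuclideanSpace ℝ (Fin 3)) : ℝ :=
  ∫ t in (0 : ℝ)..T, (hermiteDeriv T z t ^ 2 - hermite T z t ^ 2)

lemma continuous_hermiteQuad (T : ℝ) : Continuous (hermiteQuad T) := by
  unfold hermiteQuad; fun_prop

lemma continuous_hermiteCub (T : ℝ) : Continuous (hermiteCub T) := by
  unfold hermiteCub; fun_prop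

lemma continuous_hermite (T : ℝ) : Continuous fun p : _ × ℝ => hermite T p.1 p.2 := by
  have := continuous_hermiteQuad T
  have := continuous_hermiteCub T
  unfold hermite; fun_prop

lemma continuous_hermiteDeriv (T : ℝ) : Continuous fun p : _ × ℝ => hermiteDeriv T p.1 p.2 := by
  have := continuous_hermiteQuad T
  have := continuous_hermiteCub T
  unfold hermiteDeriv; fun_prop

lemma continuous_hermiteEnergy (T : ℝ) : Continuous (hermiteEnergy T) :=
  intervalIntegral.continuous_parametric_intervalIntegral_of_continuous'
    (((continuous_hermiteDeriv T).pow 2).sub ((continuous_hermite T).pow 2)) 0 T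

lemma hasDerivAt_hermite (T : ℝ) (z) (t : ℝ) :
    HasDerivAt (hermite T z) (hermiteDeriv T z t) t := by
  have := ((((hasDerivAt_id t).const_mul (z.1 0)).const_add (z.1 1)).add
    ((hasDerivAt_pow 2 t).const_mul (hermiteQuad T z))).add
    ((hasDerivAt_pow 3 t).const_mul (hermiteCub T z))
  refine this.congr_deriv ?_
  simp [hermiteDeriv]

lemma hasDerivAt_hermiteDeriv (T : ℝ) (z) (t : ℝ) :
    HasDerivAt (hermiteDeriv T z) (hermiteQuad T z * 2 + hermiteCub T z * (6 * t)) t := by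
  have := ((((hasDerivAt_id t).const_mul 2).const_mul (hermiteQuad T z)).const_add (z.1 0)).add
    (((hasDerivAt_pow 2 t).const_mul 3).const_mul (hermiteCub T z))
  refine this.congr_deriv ?_
  push_cast
  ring

/-- Local controllability towards the targets whose `x₃` defect has the sign of the quadratic form
at a given variation. -/
lemma IsVariation.locally_controllable {T : ℝ} (hT : 0 < T) {ψ : ℝ → ℝ} (hψ : IsVariation T ψ)
    {q : ℝ} (hqψ : ∫ t in (0 : ℝ)..T, (deriv ψ t ^ 2 - ψ t ^ 2) = q) (hq : q ≠ 0)
    (m : ℕ) {η : ℝ} (hη : 0 < η) :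
    ∃ δ > (0 : ℝ), ∀ xs xd : EuclideanSpace ℝ (Fin 3), ‖xs‖ + ‖xd‖ ≤ δ →
      0 ≤ q * (xd 2 - xs 2 - hermiteEnergy T (xs, xd)) →
      ∃ (x : ℝ → EuclideanSpace ℝ (Fin 3)) (u : ℝ → ℝ),
        IsTrajBrockett T x u ∧ ContDiff ℝ (⊤ : ℕ∞) u ∧
        (∀ i ≤ m, ∀ t ∈ Set.Icc (0 : ℝ) T, |iteratedDeriv i u t| ≤ η) ∧
        x 0 = xs ∧ x T = xd := by
  have hψ1 : ContDiff ℝ (⊤ : ℕ∞) (deriv ψ) :=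
    (contDiff_infty_iff_deriv.1 hψ.contDiff).2
  have hψ2 : ContDiff ℝ (⊤ : ℕ∞) (deriv (deriv ψ)) :=
    (contDiff_infty_iff_deriv.1 hψ1).2
  have hdψ : ∀ t, HasDerivAt ψ (deriv ψ t) t := fun t =>
    ((contDiff_infty_iff_deriv.1 hψ.contDiff).1 t).hasDerivAt
  have hdψ1 : ∀ t, HasDerivAt (deriv ψ) (deriv (deriv ψ) t) t := fun t =>
    ((contDiff_infty_iff_deriv.1 hψ1).1 t).hasDerivAt
  have hcψ := hψ.contDiff.continuous
  have hcψ1 := hψ1.continuous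
  obtain ⟨ε, hε, hsmall⟩ := exists_iteratedDeriv_linearCombination_le
    (f := fun _ => 2) (g := fun t => 6 * t) contDiff_const (by fun_prop) hψ2 T m hη
  let b : EuclideanSpace ℝ (Fin 3) × EuclideanSpace ℝ (Fin 3) → ℝ := fun z =>
    ∫ t in (0 : ℝ)..T, (hermiteDeriv T z t * deriv ψ t - hermite T z t * ψ t)
  have hb : Continuous b :=
    intervalIntegral.continuous_parametric_intervalIntegral_of_continuous'
      (((continuous_hermiteDeriv T).mul (hcψ1.comp continuous_snd)).sub
        ((continuous_hermite T).mul (hcψ.comp continuous_snd))) 0 T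
  let c : EuclideanSpace ℝ (Fin 3) × EuclideanSpace ℝ (Fin 3) → ℝ := fun z =>
    z.2 2 - z.1 2 - hermiteEnergy T z
  have hc : Continuous c := by
    have := continuous_hermiteEnergy T
    fun_prop
  let a : EuclideanSpace ℝ (Fin 3) × EuclideanSpace ℝ (Fin 3) → ℝ := fun z =>
    (-b z + √(b z ^ 2 + q * c z)) / q
  have ha : Continuous a := by fun_prop
  have hA0 : hermiteQuad T 0 = 0 := by simp [hermiteQuad]
  have hB0 : hermiteCub T 0 = 0 := by simp [hermiteCub]
  have ha0 : a 0 = 0 := by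
    simp [a, b, c, hermiteEnergy, hermite, hermiteDeriv, hA0, hB0]
  have hev : ∀ {k : EuclideanSpace ℝ (Fin 3) × EuclideanSpace ℝ (Fin 3) → ℝ},
      Continuous k → k 0 = 0 → ∀ᶠ z in nhds 0, |k z| ≤ ε := fun {k} hk h0 =>
    (hk.abs.tendsto 0).eventually (Iic_mem_nhds (by simpa [h0] using hε))
  obtain ⟨δ, hδ, hball⟩ := Metric.eventually_nhds_iff.1
    ((hev (continuous_hermiteQuad T) hA0).and
      ((hev (continuous_hermiteCub T) hB0).and (hev ha ha0)))
  refine ⟨δ / 2, by positivity, fun xs xd hx hsign => ?_⟩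
  set z := (xs, xd) with hz
  have hdist : dist z 0 < δ := by
    rw [dist_zero_right, hz, Prod.norm_mk]
    have := norm_nonneg xs
    have := norm_nonneg xd
    exact max_lt (by linarith) (by linarith)
  obtain ⟨hA, hB, ha⟩ := hball hdist
  have hcP : Continuous (hermite T z) :=
    (continuous_hermite T).comp (by fun_prop : Continuous fun t => (z, t))
  have hcP1 : Continuous (hermiteDeriv T z) :=
    (continuous_hermiteDeriv T).comp (by fun_prop : Continuous fun t => (z, t))
  have hu : ContDiff ℝ (⊤ : ℕ∞)
      fun t => hermiteQuad T z * 2 + hermiteCub T z * (6 * t) + a z * deriv (deriv ψ) t := by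
    fun_prop
  refine ⟨_, _, isTrajBrockett_of_hasDerivAt T (xs 2)
    (fun t => (hasDerivAt_hermite T z t).add ((hdψ t).const_mul (a z)))
    (fun t => (hasDerivAt_hermiteDeriv T z t).add ((hdψ1 t).const_mul (a z))) hu.continuous,
    hu, hsmall _ _ _ hA hB ha, ?_, ?_⟩
  · ext i
    fin_cases i
    · simp [hermiteDeriv, hψ.deriv_left, hz]
    · simp [hermite, hψ.zero_left, hz]
    · simp
  · have hint : ∫ s in (0 : ℝ)..T, ((hermiteDeriv T z s + a z * deriv ψ s) ^ 2
        - (hermite T z s + a z * ψ s) ^ 2) = xd 2 - xs 2 := by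
      have hexp : ∀ s, (hermiteDeriv T z s + a z * deriv ψ s) ^ 2
          - (hermite T z s + a z * ψ s) ^ 2
          = (hermiteDeriv T z s ^ 2 - hermite T z s ^ 2)
            + 2 * a z * (hermiteDeriv T z s * deriv ψ s - hermite T z s * ψ s)
            + a z ^ 2 * (deriv ψ s ^ 2 - ψ s ^ 2) := fun s => by ring
      simp only [hexp]
      rw [intervalIntegral.integral_add, intervalIntegral.integral_add,
        intervalIntegral.integral_const_mul, intervalIntegral.integral_const_mul, hqψ]
      · have := quadratic_root (b := b z) hq hsign
        change hermiteEnergy T z + 2 * a z * b z + a z ^ 2 * q = _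
        linear_combination this
      all_goals exact Continuous.intervalIntegrable (by fun_prop) _ _
    ext i
    fin_cases i
    · simp [hermiteDeriv, hermiteQuad, hermiteCub, hψ.deriv_right, hz]
      field_simp
      ring
    · simp [hermite, hermiteQuad, hermiteCub, hψ.zero_right, hz]
      field_simp
      ring
    · simp [hint]

/-- For every `T > π`, the system `ẋ₁ = u, ẋ₂ = x₁, ẋ₃ = x₁² − x₂²` is smoothly
locally controllable in time `T`: for every `m ∈ ℕ` and `η > 0` there exists
`δ > 0` such that any two states `x*, x†` with `|x*| + |x†| ≤ δ` are joined by a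
trajectory on `[0,T]` whose control is smooth with `‖u‖_{Cᵐ(0,T)} ≤ η`. -/
theorem statement8
    (T : ℝ) (hT : Real.pi < T) :
    ∀ m : ℕ, ∀ η > (0:ℝ), ∃ δ > (0:ℝ),
      ∀ xs xd : EuclideanSpace ℝ (Fin 3), ‖xs‖ + ‖xd‖ ≤ δ →
        ∃ (x : ℝ → EuclideanSpace ℝ (Fin 3)) (u : ℝ → ℝ),
          IsTrajBrockett T x u ∧
          ContDiff ℝ (⊤ : ℕ∞) u ∧
          (∀ i ≤ m, ∀ t ∈ Set.Icc (0:ℝ) T, |iteratedDeriv i u t| ≤ η) ∧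
          x 0 = xs ∧ x T = xd := by
  intro m η hη
  have hT0 : 0 < T := Real.pi_pos.trans hT
  obtain ⟨ψp, hp, hqp⟩ := exists_isVariation_pos hT0
  obtain ⟨ψn, hn, hqn⟩ := exists_isVariation_neg hT
  obtain ⟨δp, hδp, Hp⟩ := hp.locally_controllable hT0 rfl hqp.ne' m hη
  obtain ⟨δn, hδn, Hn⟩ := hn.locally_controllable hT0 rfl hqn.ne m hη
  refine ⟨min δp δn, lt_min hδp hδn, fun xs xd hx => ?_⟩
  rcases le_total 0 (xd 2 - xs 2 - hermiteEnergy T (xs, xd)) with h | h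
  · exact Hp xs xd (hx.trans (min_le_left _ _)) (mul_nonneg hqp.le h)
  · exact Hn xs xd (hx.trans (min_le_right _ _)) (mul_nonneg_of_nonpos_of_nonpos hqn.le h)
end
end

section
/- Consider Sussmann's system on ℝ³: ẋ₁ = u, ẋ₂ = x₁, ẋ₃ = x₁³ + x₂². Let T > 0 and let (x,u) be a trajectory with x(0) = 0, u ∈ W^{1,∞}((0,T),ℝ) with ‖u‖_{W^{1,∞}(0,T)} ≤ 1/2, and x₁(T) = x₂(T) = 0. Then x₃(T) = ∫₀ᵀ u₂(t)²(1 + u̇(t)) dt ≥ ½ ∫₀ᵀ u₂(t)² dt ≥ 0, where u₁(t) := ∫₀ᵗ u and u₂(t) := ∫₀ᵗ u₁. In particular, the system is not W^{1,∞}-small-time locally controllable: states of the form (0,0,−δ) with δ > 0 are unreachable from 0 with controls of W^{1,∞}-norm at most 1/2. -/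
open MeasureTheory

noncomputable section

/-- A trajectory of Sussmann's system `ẋ₁ = u, ẋ₂ = x₁, ẋ₃ = x₁³ + x₂²`
on `[0,T]` with control `u ∈ L¹((0,T),ℝ)`: `x : [0,T] → ℝ³` is continuous and the
corresponding integral equations hold. Components are indexed `0, 1, 2`. -/
def IsTrajSussmann (T : ℝ) (x : ℝ → EuclideanSpace ℝ (Fin 3)) (u : ℝ → ℝ) : Prop :=
  ContinuousOn x (Set.Icc 0 T) ∧ IntervalIntegrable u volume 0 T ∧
    ∀ t ∈ Set.Icc (0:ℝ) T,
      x t 0 = x 0 0 + ∫ s in (0:ℝ)..t, u s ∧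
      x t 1 = x 0 1 + ∫ s in (0:ℝ)..t, x s 0 ∧
      x t 2 = x 0 2 + ∫ s in (0:ℝ)..t, ((x s 0)^3 + (x s 1)^2)

/-- The second iterated primitive `u₂` of `u`: `u₂(t) := ∫₀ᵗ (∫₀ˢ u(r) dr) ds`. -/
def u2prim (u : ℝ → ℝ) (t : ℝ) : ℝ := ∫ s in (0:ℝ)..t, (∫ r in (0:ℝ)..s, u r)

lemma hasDerivAt_u2prim {u : ℝ → ℝ} (hu : Continuous u) (t : ℝ) :
    HasDerivAt (u2prim u) (∫ r in (0:ℝ)..t, u r) t :=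
  (intervalIntegral.continuous_primitive (fun a b => hu.intervalIntegrable a b) 0)
    |>.integral_hasStrictDerivAt 0 t |>.hasDerivAt

/-- If both iterated primitives of `u` vanish at `T`, integrating by parts twice turns
`∫ u₁³` into `∫ u₂² u̇`. -/
lemma integral_primitive_pow_three {u : ℝ → ℝ} (hu : ContDiff ℝ 1 u) {T : ℝ}
    (h₁ : ∫ r in (0:ℝ)..T, u r = 0) (h₂ : u2prim u T = 0) :
    ∫ t in (0:ℝ)..T, (∫ r in (0:ℝ)..t, u r) ^ 3 =
      ∫ t in (0:ℝ)..T, (u2prim u t) ^ 2 * deriv u t := by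
  have hd₁ (t : ℝ) : HasDerivAt (fun t => ∫ r in (0:ℝ)..t, u r) (u t) t :=
    (hu.continuous.integral_hasStrictDerivAt 0 t).hasDerivAt
  have hd₂ := hasDerivAt_u2prim hu.continuous
  have hd (t : ℝ) : HasDerivAt u (deriv u t) t :=
    (hu.differentiable one_ne_zero t).hasDerivAt
  have hc₁ : Continuous fun t => ∫ r in (0:ℝ)..t, u r :=
    continuous_iff_continuousAt.2 fun t => (hd₁ t).continuousAt
  have hc₂ : Continuous (u2prim u) :=
    continuous_iff_continuousAt.2 fun t => (hd₂ t).continuousAt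
  have hc : Continuous (deriv u) := hu.continuous_deriv le_rfl
  have hi₁ : IntervalIntegrable (fun t => (∫ r in (0:ℝ)..t, u r) ^ 3) volume 0 T :=
    (hc₁.pow 3).intervalIntegrable 0 T
  have hi₂ : IntervalIntegrable (fun t => (u2prim u t) ^ 2 * deriv u t) volume 0 T :=
    ((hc₂.pow 2).mul hc).intervalIntegrable 0 T
  rw [← sub_eq_zero, ← intervalIntegral.integral_sub hi₁ hi₂,
    intervalIntegral.integral_eq_sub_of_hasDerivAt
      (f := fun t => u2prim u t * (∫ r in (0:ℝ)..t, u r) ^ 2 - u2prim u t ^ 2 * u t)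
      (fun t _ => ?_) (hi₁.sub hi₂)]
  · simp [h₁, h₂, show u2prim u 0 = 0 from intervalIntegral.integral_same]
  · refine (((hd₂ t).mul ((hd₁ t).pow 2)).sub (((hd₂ t).pow 2).mul (hd t))).congr_deriv ?_
    simp only [Pi.pow_apply]
    ring

/-- For Sussmann's system `ẋ₁ = u, ẋ₂ = x₁, ẋ₃ = x₁³ + x₂²`: if `x(0) = 0`,
`u ∈ W^{1,∞}` with `‖u‖_{W^{1,∞}(0,T)} ≤ 1/2` and `x₁(T) = x₂(T) = 0`, then
`x₃(T) = ∫₀ᵀ u₂²(1 + u̇) ≥ ½ ∫₀ᵀ u₂² ≥ 0`.  In particular the system is not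
`W^{1,∞}`-small-time locally controllable: no state `(0,0,−δ)`, `δ > 0`, is
reachable from `0` with controls of `W^{1,∞}`-norm at most `1/2`. -/
theorem statement9
    (T : ℝ) (hT : 0 < T)
    (x : ℝ → EuclideanSpace ℝ (Fin 3)) (u : ℝ → ℝ)
    (hx : IsTrajSussmann T x u)
    (hx0 : x 0 = 0)
    (hu : ContDiff ℝ 1 u)
    (hunorm : ∀ t ∈ Set.Icc (0:ℝ) T, |u t| ≤ 1/2 ∧ |deriv u t| ≤ 1/2)
    (hxT1 : x T 0 = 0) (hxT2 : x T 1 = 0) :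
    x T 2 = (∫ t in (0:ℝ)..T, (u2prim u t)^2 * (1 + deriv u t)) ∧
    (1/2) * (∫ t in (0:ℝ)..T, (u2prim u t)^2) ≤ x T 2 ∧
    0 ≤ x T 2 := by
  obtain ⟨-, -, hx⟩ := hx
  have h0 (i : Fin 3) : x 0 i = 0 := by simp [hx0]
  simp only [h0, zero_add] at hx
  have hmem {t s : ℝ} (ht : t ∈ Set.Icc 0 T) (hs : s ∈ Set.uIcc 0 t) : s ∈ Set.Icc 0 T := by
    rw [Set.uIcc_of_le ht.1] at hs
    exact ⟨hs.1, hs.2.trans ht.2⟩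
  have hx₂ (t : ℝ) (ht : t ∈ Set.Icc 0 T) : x t 1 = u2prim u t :=
    (hx t ht).2.1.trans <| intervalIntegral.integral_congr fun s hs => (hx s (hmem ht hs)).1
  have hTmem : T ∈ Set.Icc 0 T := ⟨hT.le, le_rfl⟩
  have hc₁ : Continuous fun t => ∫ r in (0:ℝ)..t, u r :=
    intervalIntegral.continuous_primitive (fun a b => hu.continuous.intervalIntegrable a b) 0
  have hc₂ : Continuous (u2prim u) :=
    continuous_iff_continuousAt.2 fun t => (hasDerivAt_u2prim hu.continuous t).continuousAt
  have hc : Continuous (deriv u) := hu.continuous_deriv le_rfl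
  have key : x T 2 = ∫ t in (0:ℝ)..T, (u2prim u t)^2 * (1 + deriv u t) := by
    have hcongr : x T 2 = ∫ t in (0:ℝ)..T, ((∫ r in (0:ℝ)..t, u r) ^ 3 + u2prim u t ^ 2) :=
      (hx T hTmem).2.2.trans <| intervalIntegral.integral_congr fun s hs => by
        have hs' := hmem hTmem hs
        simp only [(hx s hs').1, hx₂ s hs']
    have hi₃ : IntervalIntegrable (fun t => (∫ r in (0:ℝ)..t, u r) ^ 3) volume 0 T :=
      (hc₁.pow 3).intervalIntegrable 0 T
    have hi₂ : IntervalIntegrable (fun t => u2prim u t ^ 2) volume 0 T :=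
      (hc₂.pow 2).intervalIntegrable 0 T
    have hi : IntervalIntegrable (fun t => u2prim u t ^ 2 * deriv u t) volume 0 T :=
      ((hc₂.pow 2).mul hc).intervalIntegrable 0 T
    rw [hcongr, intervalIntegral.integral_add hi₃ hi₂,
      integral_primitive_pow_three hu ((hx T hTmem).1.symm.trans hxT1)
        ((hx₂ T hTmem).symm.trans hxT2),
      ← intervalIntegral.integral_add hi hi₂]
    congr 1 with t
    ring
  have hle : (1/2) * (∫ t in (0:ℝ)..T, (u2prim u t)^2) ≤ x T 2 := by
    rw [key, ← intervalIntegral.integral_const_mul]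
    refine intervalIntegral.integral_mono_on hT.le
      (Continuous.intervalIntegrable (by fun_prop) 0 T)
      (Continuous.intervalIntegrable (by fun_prop) 0 T) fun t ht => ?_
    have h := (abs_le.1 (hunorm t ht).2).1
    nlinarith [sq_nonneg (u2prim u t)]
  have hnonneg : 0 ≤ ∫ t in (0:ℝ)..T, (u2prim u t)^2 :=
    intervalIntegral.integral_nonneg hT.le fun t _ => sq_nonneg _
  exact ⟨key, hle, by linarith⟩
end
end

section
/- Let f ∈ C¹(ℝⁿ×ℝ, ℝⁿ) with f(0,0) = 0. For every 𝒯 > 0 there exist C > 0 and η > 0 such that for every T ∈ (0,𝒯] and every trajectory (x,u) ∈ C⁰([0,T],ℝⁿ) × L^∞((0,T),ℝ) of ẋ = f(x,u) with x(0) = 0 and ‖u‖_{L^∞(0,T)} ≤ η, one has |x(t)| ≤ C ‖u‖_{L¹(0,T)} for all t ∈ [0,T]. -/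
open MeasureTheory

noncomputable section

/-- **Grönwall's inequality**, integral form with constant coefficients. -/
theorem le_mul_exp_of_le_add_mul_integral {φ : ℝ → ℝ} {A L b : ℝ} (hA : 0 ≤ A) (hL : 0 ≤ L)
    (hφ : ContinuousOn φ (Set.Icc 0 b)) (hφ0 : ∀ t ∈ Set.Icc 0 b, 0 ≤ φ t)
    (h : ∀ t ∈ Set.Icc 0 b, φ t ≤ A + L * ∫ s in (0:ℝ)..t, φ s) :
    ∀ t ∈ Set.Icc 0 b, φ t ≤ A * Real.exp (L * t) := by
  have hderiv : ∀ t ∈ Set.Icc 0 b,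
      HasDerivWithinAt (fun t => A + L * ∫ s in (0:ℝ)..t, φ s) (L * φ t) (Set.Icc 0 b) t := by
    intro t ht
    have : Fact (t ∈ Set.Icc 0 b) := ⟨ht⟩
    refine ((intervalIntegral.integral_hasDerivWithinAt_right ?_
      (hφ.stronglyMeasurableAtFilter_nhdsWithin measurableSet_Icc t)
      (hφ t ht)).const_mul L).const_add A
    refine (hφ.mono ?_).intervalIntegrable
    rw [Set.uIcc_of_le ht.1]
    exact Set.Icc_subset_Icc_right ht.2
  have hnonneg : ∀ t ∈ Set.Icc 0 b, 0 ≤ A + L * ∫ s in (0:ℝ)..t, φ s :=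
    fun t ht => (hφ0 t ht).trans (h t ht)
  intro t ht
  have key := norm_le_gronwallBound_of_norm_deriv_right_le (δ := A) (K := L) (ε := 0)
    (fun s hs => (hderiv s hs).continuousWithinAt)
    (fun s hs => (hderiv s (Set.Ico_subset_Icc_self hs)).mono_of_mem_nhdsWithin
      (Icc_mem_nhdsGE_of_mem hs))
    (by simp [abs_of_nonneg hA])
    (fun s hs => by
      have hs' := Set.Ico_subset_Icc_self hs
      rw [Real.norm_of_nonneg (mul_nonneg hL (hφ0 s hs')), Real.norm_of_nonneg (hnonneg s hs'),
        add_zero]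
      exact mul_le_mul_of_nonneg_left (h s hs') hL) t ht
  rw [gronwallBound_ε0, sub_zero, Real.norm_of_nonneg (hnonneg t ht)] at key
  exact (h t ht).trans key

/-- A primitive starting at `0` of a function of at most linear growth, forced by `w`, is
controlled by the integral of `w`. -/
theorem norm_le_of_eq_integral_of_norm_le {E : Type*} [NormedAddCommGroup E] [NormedSpace ℝ E]
    {x v : ℝ → E} {w : ℝ → ℝ} {L b : ℝ} (hL : 0 ≤ L) (hb : 0 ≤ b)
    (hx : ContinuousOn x (Set.Icc 0 b)) (hw : IntervalIntegrable w volume 0 b)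
    (hw0 : ∀ s, 0 ≤ w s) (hxv : ∀ t ∈ Set.Icc 0 b, x t = ∫ s in (0:ℝ)..t, v s)
    (hv : ∀ᵐ s ∂volume, s ∈ Set.Ioo 0 b → ‖v s‖ ≤ L * (‖x s‖ + w s)) :
    ∀ t ∈ Set.Icc 0 b, ‖x t‖ ≤ (L * ∫ s in (0:ℝ)..b, w s) * Real.exp (L * t) := by
  refine le_mul_exp_of_le_add_mul_integral
    (mul_nonneg hL (intervalIntegral.integral_nonneg hb fun s _ => hw0 s)) hL hx.norm
    (fun _ _ => norm_nonneg _) fun t ht => ?_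
  have hsub : Set.uIcc 0 t ⊆ Set.uIcc 0 b := by
    rw [Set.uIcc_of_le ht.1, Set.uIcc_of_le hb]
    exact Set.Icc_subset_Icc_right ht.2
  have hxi : IntervalIntegrable (fun s => ‖x s‖) volume 0 t := by
    refine (hx.norm.mono ?_).intervalIntegrable
    rwa [Set.uIcc_of_le hb] at hsub
  have hwi := hw.mono_set hsub
  have hwt : ∫ s in (0:ℝ)..t, w s ≤ ∫ s in (0:ℝ)..b, w s :=
    intervalIntegral.integral_mono_interval le_rfl ht.1 ht.2 (.of_forall hw0) hw
  calc ‖x t‖ = ‖∫ s in (0:ℝ)..t, v s‖ := by rw [hxv t ht]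
    _ ≤ ∫ s in (0:ℝ)..t, L * (‖x s‖ + w s) := by
        refine intervalIntegral.norm_integral_le_of_norm_le ht.1 ?_ ((hxi.add hwi).const_mul L)
        filter_upwards [hv, Measure.ae_ne volume b] with s hs hsb hst
        exact hs ⟨hst.1, lt_of_le_of_ne (hst.2.trans ht.2) hsb⟩
    _ = L * (∫ s in (0:ℝ)..t, w s) + L * ∫ s in (0:ℝ)..t, ‖x s‖ := by
        rw [intervalIntegral.integral_const_mul, intervalIntegral.integral_add hxi hwi]
        ring
    _ ≤ _ := by gcongr

/-- A `C¹` function vanishing at the origin has at most linear growth near the origin. -/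
theorem exists_norm_le_mul_add_abs_of_contDiff {E F : Type*} [NormedAddCommGroup E]
    [NormedSpace ℝ E] [NormedAddCommGroup F] [NormedSpace ℝ F] {f : E → ℝ → F}
    (hf : ContDiff ℝ 1 (fun p : E × ℝ => f p.1 p.2)) (hf0 : f 0 0 = 0) :
    ∃ L > (0:ℝ), ∃ r > (0:ℝ), ∀ y a, ‖y‖ < r → |a| < r → ‖f y a‖ ≤ L * (‖y‖ + |a|) := by
  obtain ⟨K, S, hS, hK⟩ := (hf.contDiffAt (x := (0, 0))).exists_lipschitzOnWith
  obtain ⟨r, hr, hrS⟩ := Metric.mem_nhds_iff.mp hS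
  refine ⟨K + 1, by positivity, r, hr, fun y a hy ha => ?_⟩
  have hmem : (y, a) ∈ S := hrS (by
    simp [Prod.dist_eq, hy, ha])
  have hlip := hK.dist_le_mul _ hmem _ (mem_of_mem_nhds hS)
  simp only [hf0, dist_zero_right, Prod.dist_eq, Real.norm_eq_abs] at hlip
  refine hlip.trans ?_
  gcongr
  · linarith
  · exact max_le (by linarith [abs_nonneg a]) (by linarith [norm_nonneg y])

/-- For `f ∈ C¹` with `f(0,0) = 0`: for every `𝒯 > 0` there are `C, η > 0` such
that for every `T ∈ (0,𝒯]` and every trajectory with `x(0) = 0` and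
`‖u‖_{L^∞(0,T)} ≤ η`, one has `|x(t)| ≤ C ‖u‖_{L¹(0,T)}` on `[0,T]`. -/
theorem statement16
    (n : ℕ) (hn : 0 < n) (f : Euc n → ℝ → Euc n)
    (hf : ContDiff ℝ 1 (fun p : Euc n × ℝ => f p.1 p.2))
    (hf0 : f 0 0 = 0) :
    ∀ Tc > (0:ℝ), ∃ C > (0:ℝ), ∃ η > (0:ℝ),
      ∀ T, 0 < T → T ≤ Tc →
      ∀ (x : ℝ → Euc n) (u : ℝ → ℝ),
        IsTrajectory f T x u → x 0 = 0 →
        (∀ᵐ s ∂volume, s ∈ Set.Ioo (0:ℝ) T → |u s| ≤ η) →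
        ∀ t ∈ Set.Icc (0:ℝ) T, ‖x t‖ ≤ C * ∫ s in (0:ℝ)..T, |u s| := by
  intro Tc hTc
  obtain ⟨L, hL, r, hr, hgrowth⟩ := exists_norm_le_mul_add_abs_of_contDiff hf hf0
  have hC : 0 < L * Real.exp (L * Tc) := by positivity
  set C := L * Real.exp (L * Tc) with hCdef
  have hη : 0 < r / (C * Tc + 1) / 2 := by positivity
  set η := r / (C * Tc + 1) / 2 with hηdef
  have hηeq : η * (C * Tc + 1) = r / 2 := by
    rw [hηdef]
    field_simp
  have hCT : 0 < C * Tc := by positivity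
  have hηr : η < r := by nlinarith
  have hCη : C * (η * Tc) < r := by nlinarith
  refine ⟨C, hC, η, hη, fun T hT hTTc x u ⟨hxc, hum, hxint⟩ hx0 hu => ?_⟩
  have huIoc : ∀ᵐ s ∂volume, s ∈ Set.Ioc 0 T → |u s| ≤ η := by
    filter_upwards [hu, Measure.ae_ne volume T] with s hs hsT hst
    exact hs ⟨hst.1, lt_of_le_of_ne hst.2 hsT⟩
  have hui : IntervalIntegrable (fun s => |u s|) volume 0 T := by
    refine (intervalIntegrable_const (c := η)).mono_fun' hum.abs.aestronglyMeasurable ?_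
    rw [Set.uIoc_of_le hT.le, Filter.EventuallyLE, ae_restrict_iff' measurableSet_Ioc]
    simpa using huIoc
  have hU : ∫ s in (0:ℝ)..T, |u s| ≤ η * Tc := by
    calc ∫ s in (0:ℝ)..T, |u s| ≤ ‖∫ s in (0:ℝ)..T, |u s|‖ := Real.le_norm_self _
      _ ≤ ∫ _ in (0:ℝ)..T, η :=
          intervalIntegral.norm_integral_le_of_norm_le hT.le (by simpa using huIoc)
            intervalIntegrable_const
      _ = η * T := by simp [mul_comm]
      _ ≤ η * Tc := by gcongr
  have hbound : ∀ b ∈ Set.Icc 0 T, (∀ s ∈ Set.Ioo 0 b, ‖x s‖ < r) →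
      ‖x b‖ ≤ C * ∫ s in (0:ℝ)..T, |u s| := by
    intro b hb hsmall
    have hIcc : Set.Icc 0 b ⊆ Set.Icc 0 T := Set.Icc_subset_Icc_right hb.2
    have hub : ∫ s in (0:ℝ)..b, |u s| ≤ ∫ s in (0:ℝ)..T, |u s| :=
      intervalIntegral.integral_mono_interval le_rfl hb.1 hb.2
        (.of_forall fun s => abs_nonneg (u s)) hui
    have hub0 : 0 ≤ ∫ s in (0:ℝ)..b, |u s| :=
      intervalIntegral.integral_nonneg hb.1 fun s _ => abs_nonneg (u s)
    have hle := norm_le_of_eq_integral_of_norm_le (v := fun s => f (x s) (u s))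
      (w := fun s => |u s|) hL.le hb.1 (hxc.mono hIcc)
      (hui.mono_set (by rwa [Set.uIcc_of_le hb.1, Set.uIcc_of_le hT.le]))
      (fun s => abs_nonneg (u s))
      (fun t ht => by rw [hxint t (hIcc ht), hx0, zero_add])
      (by
        filter_upwards [hu] with s hs hsb
        exact hgrowth _ _ (hsmall s hsb)
          ((hs ⟨hsb.1, hsb.2.trans_le hb.2⟩).trans_lt hηr)) b ⟨hb.1, le_rfl⟩
    calc ‖x b‖ ≤ (L * ∫ s in (0:ℝ)..b, |u s|) * Real.exp (L * b) := hle
      _ ≤ (L * ∫ s in (0:ℝ)..T, |u s|) * Real.exp (L * Tc) := by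
          gcongr
          · exact mul_nonneg hL.le (hub0.trans hub)
          · exact hb.2.trans hTTc
      _ = C * ∫ s in (0:ℝ)..T, |u s| := by rw [hCdef]; ring
  have hsmall : ∀ t ∈ Set.Icc 0 T, ‖x t‖ < r := by
    by_contra! hex
    obtain ⟨t₁, ht₁, hrt₁⟩ := hex
    have hcompact : IsCompact (Set.Icc 0 T ∩ (fun t => ‖x t‖) ⁻¹' Set.Ici r) :=
      isCompact_Icc.of_isClosed_subset
        (hxc.norm.preimage_isClosed_of_isClosed isClosed_Icc isClosed_Ici) Set.inter_subset_left
    obtain ⟨t₀, ⟨ht₀, hrt₀⟩, hmin⟩ := hcompact.exists_isLeast ⟨t₁, ht₁, hrt₁⟩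
    have hlt : ∀ s ∈ Set.Ioo 0 t₀, ‖x s‖ < r := fun s hs => by
      by_contra! hrs
      exact hs.2.not_ge (hmin ⟨⟨hs.1.le, hs.2.le.trans ht₀.2⟩, hrs⟩)
    have hrle : r ≤ ‖x t₀‖ := hrt₀
    have := hbound t₀ ht₀ hlt
    have := mul_le_mul_of_nonneg_left hU hC.le
    linarith
  exact fun t ht => hbound t ht fun s hs => hsmall s ⟨hs.1.le, hs.2.le.trans ht.2⟩
end
end

section
/- Let f₀, f₁ ∈ C¹(ℝⁿ,ℝⁿ) with f₀(0) = 0. For every 𝒯 > 0 there exist C > 0 and η > 0 such that for every T ∈ (0,𝒯] and every trajectory (x,u) ∈ C⁰([0,T],ℝⁿ) × L¹((0,T),ℝ) of ẋ = f₀(x) + u f₁(x) with x(0) = 0 and ‖u₁‖_{L^∞(0,T)} ≤ η, one has |x(t)| ≤ C (|u₁(t)| + ‖u₁‖_{L¹(0,T)}) for all t ∈ [0,T], where u₁(t) := ∫₀ᵗ u(s) ds. -/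
open MeasureTheory

noncomputable section

/-- A trajectory of the control-affine system `ẋ = f₀(x) + u f₁(x)` on `[0,T]`:
`x` is continuous on `[0,T]`, `u ∈ L¹((0,T),ℝ)`, and the integral equation
`x(t) = x(0) + ∫₀ᵗ (f₀(x(s)) + u(s) f₁(x(s))) ds` holds on `[0,T]`. -/
def IsTrajectoryAff {n : ℕ} (f₀ f₁ : Euc n → Euc n) (T : ℝ)
    (x : ℝ → Euc n) (u : ℝ → ℝ) : Prop :=
  ContinuousOn x (Set.Icc 0 T) ∧ IntervalIntegrable u volume 0 T ∧
    ∀ t ∈ Set.Icc (0:ℝ) T, x t = x 0 + ∫ s in (0:ℝ)..t, (f₀ (x s) + u s • f₁ (x s))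

section StraightenedFlow

open Set Filter Topology
open scoped NNReal

variable {E : Type*} [NormedAddCommGroup E] [NormedSpace ℝ E]

/-- A bounded globally Lipschitz vector field has integral curves on `(-1, 1)`
through every point at every prescribed time. -/
theorem exists_integralCurve_of_lipschitz_of_bounded [CompleteSpace E] {g : E → E} {L M : ℝ≥0}
    (hg : LipschitzWith L g) (hM : ∀ y, ‖g y‖ ≤ M) {τ : ℝ} (hτ : τ ∈ Ioo (-1 : ℝ) 1) (y : E) :
    ∃ γ : ℝ → E, γ τ = y ∧ ∀ t ∈ Ioo (-1 : ℝ) 1, HasDerivAt γ (g (γ t)) t := by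
  have hPL : IsPicardLindelof (fun _ : ℝ => g) (tmin := -1) (tmax := 1)
      ⟨τ, Ioo_subset_Icc_self hτ⟩ y (2 * M) 0 M L :=
    { lipschitzOnWith := fun _ _ => hg.lipschitzOnWith
      continuousOn := fun _ _ => continuousOn_const
      norm_le := fun _ _ z _ => hM z
      mul_max_le := by
        have h : max (1 - τ) (τ - -1) ≤ 2 := max_le (by linarith [hτ.1]) (by linarith [hτ.2])
        have := mul_le_mul_of_nonneg_left h M.coe_nonneg
        push_cast
        linarith }
  obtain ⟨γ, h0, hγ⟩ := hPL.exists_eq_forall_mem_Icc_hasDerivWithinAt₀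
  exact ⟨γ, h0, fun t ht =>
    (hγ t (Ioo_subset_Icc_self ht)).hasDerivAt (Icc_mem_nhds ht.1 ht.2)⟩

/-- Backward-in-time stability of integral curves. -/
theorem dist_zero_le_of_integralCurves {g : E → E} {L : ℝ≥0} (hg : LipschitzWith L g)
    {γ δ : ℝ → E} (hγ : ∀ t ∈ Ioo (-1 : ℝ) 1, HasDerivAt γ (g (γ t)) t)
    (hδ : ∀ t ∈ Ioo (-1 : ℝ) 1, HasDerivAt δ (g (δ t)) t) {τ : ℝ} (hτ : τ ∈ Ioo (-1 : ℝ) 1) :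
    dist (γ 0) (δ 0) ≤ Real.exp L * dist (γ τ) (δ τ) := by
  have forward : ∀ {g : E → E} {γ δ : ℝ → E} {τ : ℝ}, LipschitzWith L g →
      (∀ t ∈ Ioo (-1 : ℝ) 1, HasDerivAt γ (g (γ t)) t) →
      (∀ t ∈ Ioo (-1 : ℝ) 1, HasDerivAt δ (g (δ t)) t) → τ ∈ Ioc (-1 : ℝ) 0 →
      dist (γ 0) (δ 0) ≤ Real.exp L * dist (γ τ) (δ τ) := by
    intro g γ δ τ hg hγ hδ hτ
    have hsub : ∀ t ∈ Icc τ 0, t ∈ Ioo (-1 : ℝ) 1 := fun t ht =>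
      ⟨hτ.1.trans_le ht.1, ht.2.trans_lt one_pos⟩
    have h := dist_le_of_trajectories_ODE (v := fun _ => g) (a := τ) (b := 0) (fun _ => hg)
      (fun t ht => (hγ t (hsub t ht)).continuousAt.continuousWithinAt)
      (fun t ht => (hγ t (hsub t (Ico_subset_Icc_self ht))).hasDerivWithinAt)
      (fun t ht => (hδ t (hsub t ht)).continuousAt.continuousWithinAt)
      (fun t ht => (hδ t (hsub t (Ico_subset_Icc_self ht))).hasDerivWithinAt)
      le_rfl 0 ⟨hτ.2, le_rfl⟩
    refine h.trans ?_
    rw [mul_comm]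
    gcongr
    have := mul_le_mul_of_nonneg_left (show 0 - τ ≤ 1 by linarith [hτ.1]) L.coe_nonneg
    linarith
  rcases le_total τ 0 with h | h
  · exact forward hg hγ hδ ⟨hτ.1, h⟩
  · have reverse : ∀ {γ : ℝ → E}, (∀ t ∈ Ioo (-1 : ℝ) 1, HasDerivAt γ (g (γ t)) t) →
        ∀ t ∈ Ioo (-1 : ℝ) 1, HasDerivAt (fun r => γ (-r)) (-g (γ (-t))) t := by
      intro γ hγ t ht
      have h1 := hγ (-t) ⟨by linarith [ht.2], by linarith [ht.1]⟩
      simpa [Function.comp_def] using h1.scomp t (hasDerivAt_neg t)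
    simpa using forward (τ := -τ) hg.neg (reverse hγ) (reverse hδ)
      ⟨by linarith [hτ.2], by linarith⟩

theorem norm_sub_zero_le_of_integralCurve {g : E → E} {M : ℝ≥0} (hM : ∀ y, ‖g y‖ ≤ M)
    {γ : ℝ → E} (hγ : ∀ t ∈ Ioo (-1 : ℝ) 1, HasDerivAt γ (g (γ t)) t)
    {τ : ℝ} (hτ : τ ∈ Ioo (-1 : ℝ) 1) : ‖γ τ - γ 0‖ ≤ M * |τ| := by
  have := (convex_Ioo (-1 : ℝ) 1).norm_image_sub_le_of_norm_hasDerivWithin_le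
    (fun t ht => (hγ t ht).hasDerivWithinAt) (fun t _ => hM (γ t))
    (show (0 : ℝ) ∈ Ioo (-1 : ℝ) 1 by norm_num) hτ
  simpa using this

/-- First-order comparison of a trajectory with the integral curve of the controlled vector field
that passes through it. -/
theorem eventually_norm_integralCurve_sub_trajectory_le [CompleteSpace E] {g : E → E}
    (hg : Continuous g)
    {x p : ℝ → E} {u : ℝ → ℝ} (hx : Continuous x) (hp : Continuous p)
    (hu : ∀ a b, IntervalIntegrable u volume a b) {T t : ℝ} (ht : t ∈ Ico 0 T)
    (hxe : ∀ t ∈ Icc 0 T, x t = ∫ s in (0 : ℝ)..t, (p s + u s • g (x s)))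
    {γ : ℝ → E} (hγt : γ (∫ s in (0 : ℝ)..t, u s) = x t)
    (hγ : HasDerivAt γ (g (x t)) (∫ s in (0 : ℝ)..t, u s)) {ε : ℝ} (hε : 0 < ε) :
    ∀ᶠ s in 𝓝[>] t, ‖γ (∫ r in (0 : ℝ)..s, u r) - x s‖ ≤
      (∫ r in t..s, ‖p r‖) + ε * ∫ r in t..s, |u r| := by
  have hU : Continuous fun t => ∫ s in (0 : ℝ)..t, u s :=
    intervalIntegral.continuous_primitive hu 0
  have h1 := (hU.continuousAt (x := t)).eventually
    (hγ.isLittleO.def (half_pos hε))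
  have h2 : ∀ᶠ s in 𝓝 t, ‖g (x s) - g (x t)‖ < ε / 2 := by
    have : ContinuousAt (fun s => ‖g (x s) - g (x t)‖) t := by fun_prop
    exact this.eventually_lt_const (by simpa using half_pos hε)
  obtain ⟨d, hd, h2⟩ := Metric.eventually_nhds_iff.1 h2
  filter_upwards [nhdsWithin_le_nhds h1, Ioo_mem_nhdsGT (lt_min ht.2 (lt_add_of_pos_right t hd))]
    with s h1 hs
  obtain ⟨hts, hs⟩ := hs
  have hsT := hs.trans_le (min_le_left _ _)
  have hsd := hs.trans_le (min_le_right _ _)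
  have hug : ∀ a b, IntervalIntegrable (fun r => u r • g (x r)) volume a b := fun a b =>
    (hu a b).smul_continuousOn (hg.comp hx).continuousOn
  have hpi : ∀ a b, IntervalIntegrable p volume a b := hp.intervalIntegrable
  have hUd : (∫ r in (0 : ℝ)..s, u r) - (∫ r in (0 : ℝ)..t, u r) = ∫ r in t..s, u r :=
    intervalIntegral.integral_interval_sub_left (hu _ _) (hu _ _)
  have hxd : x s - x t = (∫ r in t..s, p r) + (∫ r in t..s, u r • (g (x r) - g (x t)))
      + (∫ r in t..s, u r) • g (x t) := by
    rw [hxe s ⟨ht.1.trans hts.le, hsT.le⟩, hxe t (Ico_subset_Icc_self ht),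
      intervalIntegral.integral_interval_sub_left ((hpi _ _).add (hug _ _))
      ((hpi _ _).add (hug _ _)), intervalIntegral.integral_add (hpi _ _) (hug _ _)]
    rw [← hxe t (Ico_subset_Icc_self ht), ← intervalIntegral.integral_smul_const]
    simp only [smul_sub]
    rw [intervalIntegral.integral_sub (hug _ _)
      ((hu _ _).smul_continuousOn continuousOn_const)]
    abel
  have e1 : |∫ r in t..s, u r| ≤ ∫ r in t..s, |u r| :=
    intervalIntegral.abs_integral_le_integral_abs hts.le
  have e2 : ‖∫ r in t..s, p r‖ ≤ ∫ r in t..s, ‖p r‖ :=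
    intervalIntegral.norm_integral_le_integral_norm hts.le
  have e3 : ‖∫ r in t..s, u r • (g (x r) - g (x t))‖ ≤ ε / 2 * ∫ r in t..s, |u r| := by
    rw [← intervalIntegral.integral_const_mul]
    refine intervalIntegral.norm_integral_le_of_norm_le hts.le (ae_of_all _ fun r hr => ?_)
      ((hu _ _).abs.const_mul _)
    rw [norm_smul, Real.norm_eq_abs, mul_comm]
    gcongr
    refine (h2 ?_).le
    rw [Real.dist_eq, abs_lt]
    constructor <;> linarith [hr.1, hr.2]
  rw [hγt, hUd, Real.norm_eq_abs] at h1
  have e4 : γ (∫ r in (0 : ℝ)..s, u r) - x s =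
      (γ (∫ r in (0 : ℝ)..s, u r) - x t - (∫ r in t..s, u r) • g (x t))
      - (∫ r in t..s, p r) - (∫ r in t..s, u r • (g (x r) - g (x t))) := by
    have : x s = x t + (x s - x t) := by abel
    rw [this, hxd]
    abel
  rw [e4]
  have e5 := mul_le_mul_of_nonneg_left e1 (half_pos hε).le
  have n1 := norm_sub_le (γ (∫ r in (0 : ℝ)..s, u r) - x t - (∫ r in t..s, u r) • g (x t)
      - (∫ r in t..s, p r)) (∫ r in t..s, u r • (g (x r) - g (x t)))
  have n2 := norm_sub_le (γ (∫ r in (0 : ℝ)..s, u r) - x t - (∫ r in t..s, u r) • g (x t))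
      (∫ r in t..s, p r)
  linarith

/-- Along a trajectory starting at `0`, the straightening of the controlled vector field
bounds the state by the primitive of the control and the integral of the drift. -/
theorem norm_trajectory_le_primitive_add_integral_drift [CompleteSpace E] {g : E → E} {L M : ℝ≥0}
    (hg : LipschitzWith L g) (hM : ∀ y, ‖g y‖ ≤ M)
    {x p : ℝ → E} {u : ℝ → ℝ} (hx : Continuous x) (hp : Continuous p)
    (hu : ∀ a b, IntervalIntegrable u volume a b) {T : ℝ}
    (hxe : ∀ t ∈ Icc 0 T, x t = ∫ s in (0 : ℝ)..t, (p s + u s • g (x s)))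
    (hU1 : ∀ t ∈ Icc 0 T, |∫ s in (0 : ℝ)..t, u s| < 1) {t : ℝ} (ht : t ∈ Icc 0 T) :
    ‖x t‖ ≤ M * |∫ s in (0 : ℝ)..t, u s| + Real.exp L * ∫ s in (0 : ℝ)..t, ‖p s‖ := by
  set U : ℝ → ℝ := fun t => ∫ s in (0 : ℝ)..t, u s with hUdef
  have hU : Continuous U := intervalIntegral.continuous_primitive hu 0
  have hmem : ∀ t ∈ Icc 0 T, U t ∈ Ioo (-1 : ℝ) 1 := fun t ht => abs_lt.1 (hU1 t ht)
  have hex : ∀ t, ∃ γ : ℝ → E, t ∈ Icc 0 T →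
      γ (U t) = x t ∧ ∀ s ∈ Ioo (-1 : ℝ) 1, HasDerivAt γ (g (γ s)) s := fun t => by
    by_cases ht : t ∈ Icc 0 T
    · obtain ⟨γ, h⟩ := exists_integralCurve_of_lipschitz_of_bounded hg hM (hmem t ht) (x t)
      exact ⟨γ, fun _ => h⟩
    · exact ⟨fun _ => 0, fun h => absurd h ht⟩
  choose γ hγ using hex
  have hdist : ∀ t ∈ Icc 0 T, ∀ s ∈ Icc 0 T,
      ‖γ s 0 - γ t 0‖ ≤ Real.exp L * ‖γ t (U s) - x s‖ := fun t ht s hs => by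
    rw [← dist_eq_norm, dist_comm, ← dist_eq_norm, ← (hγ s hs).1]
    exact dist_zero_le_of_integralCurves hg (hγ t ht).2 (hγ s hs).2 (hmem s hs)
  have hycont : ContinuousOn (fun t => γ t 0) (Icc 0 T) := by
    intro t ht
    rw [ContinuousWithinAt, tendsto_iff_norm_sub_tendsto_zero]
    have hc : ContinuousAt (fun s => Real.exp L * ‖γ t (U s) - x s‖) t := by
      have := ((hγ t ht).2 _ (hmem t ht)).continuousAt
      have h2 : ContinuousAt (fun s => γ t (U s)) t := ContinuousAt.comp this hU.continuousAt
      exact continuousAt_const.mul (h2.sub hx.continuousAt).norm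
    refine squeeze_zero' (Eventually.of_forall fun _ => norm_nonneg _) ?_
      ((hc.tendsto.mono_left nhdsWithin_le_nhds).congr' EventuallyEq.rfl |>.trans ?_)
    · filter_upwards [self_mem_nhdsWithin] with s hs using hdist t ht s hs
    · simp [(hγ t ht).1]
  have hui : ∀ a b, IntervalIntegrable (fun r => |u r|) volume a b := fun a b => (hu a b).abs
  have hpi : ∀ a b, IntervalIntegrable (fun r => ‖p r‖) volume a b :=
    hp.norm.intervalIntegrable
  have key : ∀ ε > 0, ∀ t ∈ Icc 0 T, ‖γ t 0‖ ≤ Real.exp L *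
      ((∫ r in (0 : ℝ)..t, ‖p r‖) + ε * ∫ r in (0 : ℝ)..t, |u r|) := by
    intro ε hε
    set B : ℝ → ℝ := fun t => Real.exp L *
      ((∫ r in (0 : ℝ)..t, ‖p r‖) + ε * ∫ r in (0 : ℝ)..t, |u r|) with hB
    have hBc : Continuous B := continuous_const.mul
      ((intervalIntegral.continuous_primitive hpi 0).add
        (continuous_const.mul (intervalIntegral.continuous_primitive hui 0)))
    rcases lt_or_ge T 0 with hT | hT
    · intro t ht
      exact absurd (ht.1.trans ht.2) (not_le.2 hT)
    have h0 : (0 : ℝ) ∈ Icc 0 T := ⟨le_rfl, hT⟩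
    refine IsClosed.Icc_subset_of_forall_mem_nhdsWithin (s := {t | ‖γ t 0‖ ≤ B t}) ?_ ?_ ?_
    · have := hycont.norm.prodMk hBc.continuousOn |>.preimage_isClosed_of_isClosed isClosed_Icc
        (OrderClosedTopology.isClosed_le' (α := ℝ))
      rwa [inter_comm] at this
    · have h1 := (hγ 0 h0).1
      have h2 := hxe 0 h0
      simp only [hUdef, intervalIntegral.integral_same] at h1 h2
      simp [hB, h1, h2]
    · rintro t ⟨htB, ht⟩
      have htI := Ico_subset_Icc_self ht
      have hd := (hγ t htI).2 _ (hmem t htI)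
      rw [(hγ t htI).1] at hd
      filter_upwards [eventually_norm_integralCurve_sub_trajectory_le hg.continuous hx hp hu ht hxe
        (hγ t htI).1 hd hε, Ioo_mem_nhdsGT ht.2] with s hs hsI
      have hd := (hdist t htI s ⟨ht.1.trans hsI.1.le, hsI.2.le⟩).trans
        (mul_le_mul_of_nonneg_left hs (Real.exp_pos _).le)
      have hsum : ‖γ s 0‖ ≤ ‖γ t 0‖ + ‖γ s 0 - γ t 0‖ := by
        simpa using norm_add_le (γ t 0) (γ s 0 - γ t 0)
      have htB' : ‖γ t 0‖ ≤ B t := htB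
      change ‖γ s 0‖ ≤ B s
      have : B s = B t + Real.exp L * ((∫ r in t..s, ‖p r‖) + ε * ∫ r in t..s, |u r|) := by
        simp only [hB]
        rw [← intervalIntegral.integral_add_adjacent_intervals (hpi 0 t) (hpi t s),
          ← intervalIntegral.integral_add_adjacent_intervals (hui 0 t) (hui t s)]
        ring
      linarith
  have hy : ‖γ t 0‖ ≤ Real.exp L * ∫ r in (0 : ℝ)..t, ‖p r‖ := by
    have hlim : Tendsto (fun ε : ℝ => Real.exp L *
        ((∫ r in (0 : ℝ)..t, ‖p r‖) + ε * ∫ r in (0 : ℝ)..t, |u r|)) (𝓝[>] 0)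
        (𝓝 (Real.exp L * ((∫ r in (0 : ℝ)..t, ‖p r‖) + 0 * ∫ r in (0 : ℝ)..t, |u r|))) :=
      (Continuous.tendsto (by fun_prop) _).mono_left nhdsWithin_le_nhds
    rw [zero_mul, add_zero] at hlim
    exact ge_of_tendsto hlim (eventually_mem_nhdsWithin.mono fun ε hε => key ε hε t ht)
  have h1 := norm_sub_zero_le_of_integralCurve hM (hγ t ht).2 (hmem t ht)
  rw [(hγ t ht).1] at h1
  have h2 : ‖x t‖ ≤ ‖x t - γ t 0‖ + ‖γ t 0‖ := by simpa using norm_add_le (x t - γ t 0) (γ t 0)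
  linarith

/-- An integral Grönwall inequality with a variable forcing term. -/
theorem le_of_le_add_mul_integral {φ a : ℝ → ℝ} (hφ : Continuous φ) (ha : Continuous a)
    (ha0 : ∀ t, 0 ≤ a t) {A M T : ℝ} (hA : 0 ≤ A) (hM : 0 ≤ M)
    (h : ∀ t ∈ Icc 0 T, φ t ≤ M * a t + A * ∫ s in (0 : ℝ)..t, φ s) {t : ℝ} (ht : t ∈ Icc 0 T) :
    φ t ≤ M * a t + A * (Real.exp (A * T) * (M * ∫ s in (0 : ℝ)..t, a s)) := by
  set w : ℝ → ℝ := fun t => ∫ s in (0 : ℝ)..t, φ s with hw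
  have hderiv : ∀ t, HasDerivAt
      (fun t => Real.exp (-(A * t)) * w t - M * ∫ s in (0 : ℝ)..t, a s)
      (Real.exp (-(A * t)) * (φ t - A * w t) - M * a t) t := by
    intro t
    have h1 : HasDerivAt w (φ t) t := hφ.integral_hasStrictDerivAt 0 t |>.hasDerivAt
    have h2 : HasDerivAt (fun t => ∫ s in (0 : ℝ)..t, a s) (a t) t :=
      ha.integral_hasStrictDerivAt 0 t |>.hasDerivAt
    have h3 : HasDerivAt (fun t => Real.exp (-(A * t))) (Real.exp (-(A * t)) * -(A * 1)) t :=
      (((hasDerivAt_id t).const_mul A).neg).exp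
    exact ((h3.mul h1).sub (h2.const_mul M)).congr_deriv (by ring)
  have hanti := antitoneOn_of_deriv_nonpos (convex_Icc (0 : ℝ) T)
    (fun t _ => (hderiv t).continuousAt.continuousWithinAt)
    (fun t _ => (hderiv t).differentiableAt.differentiableWithinAt) (fun t ht => by
      have htI := interior_subset ht
      rw [(hderiv t).deriv]
      have he : Real.exp (-(A * t)) ≤ 1 :=
        Real.exp_le_one_iff.2 (neg_nonpos.2 (mul_nonneg hA htI.1))
      have h1 : φ t - A * w t ≤ M * a t := by linarith [h t htI]
      have h2 := mul_le_mul_of_nonneg_left h1 (Real.exp_pos (-(A * t))).le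
      have h3 := mul_le_mul_of_nonneg_right he (mul_nonneg hM (ha0 t))
      linarith)
  have h0 := hanti ⟨le_rfl, ht.1.trans ht.2⟩ ht ht.1
  simp only [hw, intervalIntegral.integral_same, mul_zero, sub_zero, sub_nonpos] at h0
  have hI : 0 ≤ M * ∫ s in (0 : ℝ)..t, a s :=
    mul_nonneg hM (intervalIntegral.integral_nonneg ht.1 fun s _ => ha0 s)
  have hwle : w t ≤ Real.exp (A * T) * (M * ∫ s in (0 : ℝ)..t, a s) := by
    have h1 : w t = Real.exp (A * t) * (Real.exp (-(A * t)) * w t) := by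
      rw [← mul_assoc, ← Real.exp_add, add_neg_cancel, Real.exp_zero, one_mul]
    rw [h1]
    have h2 : Real.exp (A * t) ≤ Real.exp (A * T) :=
      Real.exp_le_exp.2 (mul_le_mul_of_nonneg_left ht.2 hA)
    exact (mul_le_mul_of_nonneg_left h0 (Real.exp_pos _).le).trans
      (mul_le_mul_of_nonneg_right h2 hI)
  have := mul_le_mul_of_nonneg_left hwle hA
  linarith [h t ht]

/-- A `C¹` vector field coincides on a given ball with a bounded globally Lipschitz one. -/
theorem exists_lipschitz_bounded_eqOn_closedBall [FiniteDimensional ℝ E]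
    {f : E → E} (hf : ContDiff ℝ 1 f) :
    ∃ (g : E → E) (L M : ℝ≥0), LipschitzWith L g ∧ (∀ y, ‖g y‖ ≤ M) ∧
      EqOn g f (Metric.closedBall 0 1) := by
  let χ : ContDiffBump (0 : E) := ⟨1, 2, one_pos, one_lt_two⟩
  have hsupp : HasCompactSupport fun y => χ y • f y := χ.hasCompactSupport.smul_right
  have hsmooth : ContDiff ℝ 1 fun y => χ y • f y := χ.contDiff.smul hf
  obtain ⟨L, hL⟩ := hsmooth.lipschitzWith_of_hasCompactSupport hsupp one_ne_zero
  obtain ⟨M, hM⟩ := hsupp.exists_bound_of_continuous hsmooth.continuous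
  refine ⟨_, L, M.toNNReal, hL, fun y => (hM y).trans (Real.le_coe_toNNReal M), fun y hy => ?_⟩
  simp only [χ.one_of_mem_closedBall hy, one_smul]

end StraightenedFlow

/-- For `f₀, f₁ ∈ C¹` with `f₀(0) = 0`: for every `𝒯 > 0` there are `C, η > 0`
such that for every `T ∈ (0,𝒯]` and every trajectory of `ẋ = f₀(x) + u f₁(x)`
with `x(0) = 0` and `‖u₁‖_{L^∞(0,T)} ≤ η`, one has
`|x(t)| ≤ C (|u₁(t)| + ‖u₁‖_{L¹(0,T)})` on `[0,T]`, where `u₁(t) = ∫₀ᵗ u`. -/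
theorem statement17
    (n : ℕ) (hn : 0 < n) (f₀ f₁ : Euc n → Euc n)
    (hf₀ : ContDiff ℝ 1 f₀) (hf₁ : ContDiff ℝ 1 f₁)
    (hf00 : f₀ 0 = 0) :
    ∀ Tc > (0:ℝ), ∃ C > (0:ℝ), ∃ η > (0:ℝ),
      ∀ T, 0 < T → T ≤ Tc →
      ∀ (x : ℝ → Euc n) (u : ℝ → ℝ),
        IsTrajectoryAff f₀ f₁ T x u → x 0 = 0 →
        (∀ t ∈ Set.Icc (0:ℝ) T, |∫ s in (0:ℝ)..t, u s| ≤ η) →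
        ∀ t ∈ Set.Icc (0:ℝ) T,
          ‖x t‖ ≤ C * (|∫ s in (0:ℝ)..t, u s| +
            ∫ s in (0:ℝ)..T, |∫ r in (0:ℝ)..s, u r|) := by
  intro Tc hTc
  obtain ⟨g, L, M, hg, hM, hgf⟩ := exists_lipschitz_bounded_eqOn_closedBall hf₁
  obtain ⟨g₀, L₀, -, hg₀, -, hgf₀⟩ := exists_lipschitz_bounded_eqOn_closedBall hf₀
  have hdrift : ∀ y : Euc n, ‖y‖ ≤ 1 → ‖f₀ y‖ ≤ L₀ * ‖y‖ := fun y hy => by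
    have h := hg₀.dist_le_mul y 0
    rwa [hgf₀ (by simpa using hy), hgf₀ (by simp), hf00, dist_zero_right, dist_zero_right] at h
  set A : ℝ := Real.exp L * L₀ with hA
  have hA0 : 0 ≤ A := by positivity
  set C : ℝ := M + A * (Real.exp (A * Tc) * M) + 1 with hC
  have hCM : (M : ℝ) ≤ C := by
    have : 0 ≤ A * (Real.exp (A * Tc) * M) := by positivity
    linarith
  have hCI : A * (Real.exp (A * Tc) * M) ≤ C := by linarith [M.coe_nonneg]
  have hC1 : 1 ≤ C := by
    have : 0 ≤ A * (Real.exp (A * Tc) * M) := by positivity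
    linarith [M.coe_nonneg]
  have hC0 : 0 < C := by linarith
  refine ⟨C, hC0, 1 / (2 * C * (1 + Tc)), by positivity, ?_⟩
  set η : ℝ := 1 / (2 * C * (1 + Tc)) with hη
  have hη0 : 0 < η := by positivity
  have hηC : C * (η + Tc * η) = 1 / 2 := by
    rw [hη]
    field_simp
  have hη1 : η < 1 := by
    have h1 : 1 * η ≤ C * η := mul_le_mul_of_nonneg_right hC1 hη0.le
    have h2 : 0 ≤ C * (Tc * η) := by positivity
    linarith [mul_add C η (Tc * η)]
  intro T hT hTTc x u ⟨hxc, hu, hxe⟩ hx0 hUη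
  set X : ℝ → Euc n := fun t => x (Set.projIcc 0 T hT.le t) with hX
  have hXc : Continuous X := hxc.domRestrict.comp continuous_projIcc
  have hXx : ∀ t ∈ Set.Icc 0 T, X t = x t := fun t ht => by
    simp only [hX, Set.projIcc_of_mem hT.le ht]
  set v : ℝ → ℝ := (Set.Ioc 0 T).indicator u with hv
  have hvi : ∀ a b, IntervalIntegrable v volume a b := fun a b => by
    have h := (intervalIntegrable_iff_integrableOn_Ioc_of_le hT.le).1 hu
    exact (h.integrable_indicator measurableSet_Ioc).intervalIntegrable
  have hvu : ∀ t ∈ Set.Icc 0 T, ∀ s ∈ Set.uIoc 0 t, v s = u s := fun t ht s hs => by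
    rw [Set.uIoc_of_le ht.1] at hs
    exact Set.indicator_of_mem (show s ∈ Set.Ioc 0 T from ⟨hs.1, hs.2.trans ht.2⟩) u
  have hVU : ∀ t ∈ Set.Icc 0 T, ∫ s in (0 : ℝ)..t, v s = ∫ s in (0 : ℝ)..t, u s :=
    fun t ht => intervalIntegral.integral_congr_ae (ae_of_all _ (hvu t ht))
  have hVc : Continuous fun t => |∫ s in (0 : ℝ)..t, v s| :=
    (intervalIntegral.continuous_primitive hvi 0).abs
  have hVint : ∫ s in (0 : ℝ)..T, |∫ r in (0 : ℝ)..s, v r| =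
      ∫ s in (0 : ℝ)..T, |∫ r in (0 : ℝ)..s, u r| := by
    refine intervalIntegral.integral_congr fun s hs => ?_
    rw [Set.uIcc_of_le hT.le] at hs
    simp only [hVU s hs]
  have hVη : ∀ t ∈ Set.Icc 0 T, |∫ s in (0 : ℝ)..t, v s| ≤ η := fun t ht => by
    rw [hVU t ht]
    exact hUη t ht
  have bound : ∀ τ ∈ Set.Icc 0 T, (∀ s ∈ Set.Icc 0 τ, ‖X s‖ ≤ 1) →
      ‖X τ‖ ≤ C * (|∫ s in (0 : ℝ)..τ, v s| + ∫ s in (0 : ℝ)..T, |∫ r in (0 : ℝ)..s, v r|) := by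
    intro τ hτ hsmall
    have hsub : ∀ t ∈ Set.Icc 0 τ, t ∈ Set.Icc 0 T := fun t ht => ⟨ht.1, ht.2.trans hτ.2⟩
    have hXe : ∀ t ∈ Set.Icc 0 τ,
        X t = ∫ s in (0 : ℝ)..t, (f₀ (X s) + v s • g (X s)) := by
      intro t ht
      rw [hXx t (hsub t ht), hxe t (hsub t ht), hx0, zero_add]
      refine intervalIntegral.integral_congr_ae (ae_of_all _ fun s hs => ?_)
      rw [hvu t (hsub t ht) s hs]
      rw [Set.uIoc_of_le ht.1] at hs
      have hs' : s ∈ Set.Icc 0 τ := ⟨hs.1.le, hs.2.trans ht.2⟩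
      rw [hgf (by simpa using hsmall s hs'), hXx s (hsub s hs')]
    have hp : Continuous fun s => f₀ (X s) := hf₀.continuous.comp hXc
    have hgron := le_of_le_add_mul_integral hXc.norm hVc (fun _ => abs_nonneg _) hA0
      M.coe_nonneg (T := τ) (fun t ht => by
        refine (norm_trajectory_le_primitive_add_integral_drift hg hM hXc hp hvi hXe
          (fun t ht => (hVη t (hsub t ht)).trans_lt hη1) ht).trans ?_
        rw [hA, mul_assoc, ← intervalIntegral.integral_const_mul (L₀ : ℝ)]
        gcongr
        refine intervalIntegral.integral_mono_on ht.1 (hp.norm.intervalIntegrable _ _)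
          ((continuous_const.mul hXc.norm).intervalIntegrable _ _) fun s hs => ?_
        exact hdrift _ (hsmall s ⟨hs.1, hs.2.trans ht.2⟩)) ⟨hτ.1, le_rfl⟩
    have hI0 : 0 ≤ ∫ s in (0 : ℝ)..τ, |∫ r in (0 : ℝ)..s, v r| :=
      intervalIntegral.integral_nonneg hτ.1 fun _ _ => abs_nonneg _
    have hIT : ∫ s in (0 : ℝ)..τ, |∫ r in (0 : ℝ)..s, v r| ≤
        ∫ s in (0 : ℝ)..T, |∫ r in (0 : ℝ)..s, v r| :=
      intervalIntegral.integral_mono_interval le_rfl hτ.1 hτ.2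
        (ae_of_all _ fun _ => abs_nonneg _) (hVc.intervalIntegrable _ _)
    have hexp : Real.exp (A * τ) ≤ Real.exp (A * Tc) :=
      Real.exp_le_exp.2 (mul_le_mul_of_nonneg_left (hτ.2.trans hTTc) hA0)
    calc ‖X τ‖ ≤ _ := hgron
      _ ≤ M * |∫ s in (0 : ℝ)..τ, v s| + A * (Real.exp (A * Tc) *
          (M * ∫ s in (0 : ℝ)..T, |∫ r in (0 : ℝ)..s, v r|)) := by gcongr
      _ = M * |∫ s in (0 : ℝ)..τ, v s| + A * (Real.exp (A * Tc) * M) *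
          ∫ s in (0 : ℝ)..T, |∫ r in (0 : ℝ)..s, v r| := by ring
      _ ≤ C * |∫ s in (0 : ℝ)..τ, v s| + C * ∫ s in (0 : ℝ)..T, |∫ r in (0 : ℝ)..s, v r| := by
          have := hI0.trans hIT
          gcongr
      _ = _ := by ring
  have hIη : ∫ s in (0 : ℝ)..T, |∫ r in (0 : ℝ)..s, v r| ≤ Tc * η := by
    have h := intervalIntegral.integral_mono_on hT.le (hVc.intervalIntegrable (μ := volume) 0 T)
      (intervalIntegrable_const (c := η)) hVη
    rw [intervalIntegral.integral_const, sub_zero, smul_eq_mul] at h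
    exact h.trans (mul_le_mul_of_nonneg_right hTTc hη0.le)
  have hsmall : Set.Icc 0 T ⊆ {t | ‖X t‖ ≤ 1} := by
    refine IsClosed.Icc_subset_of_forall_mem_nhdsGT_of_Icc_subset
      ((isClosed_le hXc.norm continuous_const).inter isClosed_Icc) ?_ fun t ht hsub => ?_
    · simp [hXx 0 ⟨le_rfl, hT.le⟩, hx0]
    · have htI := Set.Ico_subset_Icc_self ht
      have h : ‖X t‖ < 1 := by
        refine (bound t htI hsub).trans_lt ?_
        have := mul_le_mul_of_nonneg_left (add_le_add (hVη t htI) hIη) hC0.le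
        linarith
      exact nhdsWithin_le_nhds
        ((hXc.norm.continuousAt.eventually_lt_const h).mono fun _ h => h.le)
  intro t ht
  rw [← hXx t ht, ← hVU t ht, ← hVint]
  exact bound t ht fun s hs => hsmall ⟨hs.1, hs.2.trans ht.2⟩
end
end

section
/- Let κ ≥ 1 be an integer. There exist constants C₁, C₂ > 0 depending only on κ such that for every L > 0 and every ψ ∈ W^{3κ−3,∞}((0,L),ℝ): ‖ψ^{(κ−1)}‖_{L³(0,L)}³ ≤ C₁ ‖ψ‖_{L²(0,L)}² ‖ψ^{(3κ−3)}‖_{L^∞(0,L)} + C₂ L^{5/2−3κ} ‖ψ‖_{L²(0,L)}³. Moreover, for every L > 0 and every ψ ∈ W^{3κ−3,∞}((0,L),ℝ) with ψ(0) = ψ'(0) = … = ψ^{(3κ−4)}(0) = 0: ‖ψ^{(κ−1)}‖_{L³(0,L)}³ ≤ (C₁ + C₂) ‖ψ‖_{L²(0,L)}² ‖ψ^{(3κ−3)}‖_{L^∞(0,L)}. -/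
noncomputable section

open Polynomial in
theorem Polynomial.iteratedDeriv_eval (p : ℝ[X]) (n : ℕ) :
    iteratedDeriv n (fun x => p.eval x) = fun x => (derivative^[n] p).eval x := by
  induction n with
  | zero => simp
  | succ n ih =>
    rw [iteratedDeriv_succ, ih, Function.iterate_succ_apply']
    funext x
    exact Polynomial.deriv _

/-- The coefficients of a polynomial of degree `< m` are controlled by its `L²` norm on `[0, 1]`. -/
theorem exists_sq_coeff_le_integral_sq (m : ℕ) :
    ∃ K > (0 : ℝ), ∀ c : Fin m → ℝ, ∀ i,
      c i ^ 2 ≤ K * ∫ t in (0 : ℝ)..1, (∑ i, c i * t ^ (i : ℕ)) ^ 2 := by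
  set Q : (Fin m → ℝ) → ℝ := fun c => ∫ t in (0 : ℝ)..1, (∑ i, c i * t ^ (i : ℕ)) ^ 2 with hQ
  have hcont : Continuous Q :=
    intervalIntegral.continuous_parametric_intervalIntegral_of_continuous' (by fun_prop) _ _
  have hpos : ∀ c ≠ 0, 0 < Q c := by
    intro c hc
    refine intervalIntegral.integral_pos one_pos (by fun_prop) (fun _ _ => sq_nonneg _) ?_
    by_contra! h
    apply hc
    set p : Polynomial ℝ := ∑ i, Polynomial.C (c i) * Polynomial.X ^ (i : ℕ) with hp
    have hp0 : p = 0 := by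
      apply Polynomial.eq_zero_of_infinite_isRoot
      refine (Set.Icc_infinite (one_pos (α := ℝ))).mono fun t ht => ?_
      have := h t ht
      simp only [Set.mem_ofPred_eq, Polynomial.IsRoot, hp, Polynomial.eval_finsetSum,
        Polynomial.eval_mul, Polynomial.eval_C, Polynomial.eval_pow, Polynomial.eval_X]
      exact pow_eq_zero_iff two_ne_zero |>.1 (le_antisymm this (sq_nonneg _))
    funext i
    have := congrArg (fun q => Polynomial.coeff q (i : ℕ)) hp0
    simpa [hp, Polynomial.coeff_X_pow, Fin.val_inj] using this
  have hhom : ∀ (r : ℝ) c, Q (r • c) = r ^ 2 * Q c := by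
    intro r c
    simp only [hQ, ← intervalIntegral.integral_const_mul]
    congr 1; funext t
    simp only [Pi.smul_apply, smul_eq_mul, mul_assoc, ← Finset.mul_sum]
    ring
  have hmin : ∃ δ > 0, ∀ c : Fin m → ℝ, ‖c‖ = 1 → δ ≤ Q c := by
    rcases (Metric.sphere (0 : Fin m → ℝ) 1).eq_empty_or_nonempty with h | h
    · refine ⟨1, one_pos, fun c hc => ?_⟩
      have : c ∈ Metric.sphere (0 : Fin m → ℝ) 1 := by simpa using hc
      simp [h] at this
    · obtain ⟨c₀, h₀, hm⟩ := (isCompact_sphere (0 : Fin m → ℝ) 1).exists_isMinOn h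
        hcont.continuousOn
      refine ⟨Q c₀, hpos _ ?_, fun c hc => hm (by simpa using hc)⟩
      rintro rfl
      simp at h₀
  obtain ⟨δ, hδ, hmin⟩ := hmin
  refine ⟨δ⁻¹, inv_pos.2 hδ, fun c i => ?_⟩
  change _ ≤ δ⁻¹ * Q c
  rcases eq_or_ne c 0 with rfl | hc
  · have := hhom 0 0
    simp at this
    simp [this]
  have hn : 0 < ‖c‖ := norm_pos_iff.2 hc
  have h1 := hmin (‖c‖⁻¹ • c) (by rw [norm_smul, norm_inv, norm_norm, inv_mul_cancel₀ hn.ne'])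
  rw [hhom, inv_pow, inv_mul_eq_div, le_div_iff₀ (by positivity)] at h1
  have h2 : c i ^ 2 ≤ ‖c‖ ^ 2 :=
    sq_le_sq' (abs_le.1 (norm_le_pi_norm c i)).1 (abs_le.1 (norm_le_pi_norm c i)).2
  rw [inv_mul_eq_div, le_div_iff₀ hδ]
  nlinarith

/-- If `g` vanishes to order `m` at `0`, its lower derivatives are controlled by the `m`-th one. -/
theorem abs_iteratedDeriv_le_of_vanishing {m : ℕ} {g : ℝ → ℝ} (hg : ContDiff ℝ m g) {B L : ℝ}
    (hL : 0 ≤ L)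
    (h0 : ∀ j < m, iteratedDeriv j g 0 = 0)
    (hB : ∀ t ∈ Set.Icc 0 L, |iteratedDeriv m g t| ≤ B) :
    ∀ k ≤ m, ∀ t ∈ Set.Icc 0 L, |iteratedDeriv (m - k) g t| ≤ B * L ^ k := by
  have hB0 : 0 ≤ B := (abs_nonneg _).trans (hB 0 ⟨le_rfl, hL⟩)
  intro k
  induction k with
  | zero => simpa using hB
  | succ k ih =>
    intro hk t ht
    have hd : Differentiable ℝ (iteratedDeriv (m - (k + 1)) g) :=
      hg.differentiable_iteratedDeriv _ (by norm_cast; omega)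
    have := Convex.norm_image_sub_le_of_norm_deriv_le (s := Set.Icc 0 L) (C := B * L ^ k)
      (fun x _ => hd x) (fun x hx => by
        rw [← iteratedDeriv_succ, show m - (k + 1) + 1 = m - k by omega]
        exact ih (by omega) x hx) (convex_Icc 0 L) ⟨le_rfl, hL⟩ ht
    rw [h0 _ (by omega), sub_zero, sub_zero, Real.norm_eq_abs, Real.norm_eq_abs,
      abs_of_nonneg ht.1] at this
    refine this.trans ?_
    rw [pow_succ, ← mul_assoc]
    exact mul_le_mul_of_nonneg_left ht.2 (by positivity)

/-- Interpolation on `[0, 1]`, by splitting off the Taylor polynomial at `0`. -/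
theorem exists_sq_iteratedDeriv_le_unit {n m : ℕ} (hnm : n ≤ m) :
    ∃ K > (0 : ℝ), ∀ (f : ℝ → ℝ) (B : ℝ), ContDiff ℝ m f →
      (∀ t ∈ Set.Icc (0 : ℝ) 1, |iteratedDeriv m f t| ≤ B) →
      ∀ t ∈ Set.Icc (0 : ℝ) 1,
        iteratedDeriv n f t ^ 2 ≤ K * ((∫ t in (0 : ℝ)..1, f t ^ 2) + B ^ 2) := by
  obtain ⟨K, hK, hcoef⟩ := exists_sq_coeff_le_integral_sq m
  set D : ℝ := ∑ i ∈ Finset.range (m + 1), ((i + n).descFactorial n : ℝ) with hD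
  have hD0 : 0 ≤ D := by positivity
  refine ⟨4 * D ^ 2 * K + 2, by positivity, fun f B hf hB t ht => ?_⟩
  have hB0 : 0 ≤ B := (abs_nonneg _).trans (hB 0 ⟨le_rfl, zero_le_one⟩)
  set c : Fin m → ℝ := fun i => iteratedDeriv i f 0 / (i : ℕ).factorial with hc
  set p : Polynomial ℝ := ∑ i, Polynomial.C (c i) * Polynomial.X ^ (i : ℕ) with hp
  have hpe : ∀ x, p.eval x = ∑ i, c i * x ^ (i : ℕ) := by
    intro x; simp [hp, Polynomial.eval_finsetSum]
  have hpc : ∀ j (h : j < m), p.coeff j = c ⟨j, h⟩ := by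
    intro j h
    simp only [hp, Polynomial.finsetSum_coeff, Polynomial.coeff_C_mul, Polynomial.coeff_X_pow]
    rw [Finset.sum_eq_single ⟨j, h⟩] <;> simp
    intro b hb hj
    exact absurd (Fin.ext hj.symm) hb
  have hpc0 : ∀ j, m ≤ j → p.coeff j = 0 := by
    intro j h
    simp only [hp, Polynomial.finsetSum_coeff, Polynomial.coeff_C_mul, Polynomial.coeff_X_pow]
    refine Finset.sum_eq_zero fun i _ => ?_
    rw [if_neg (by have := i.2; omega), mul_zero]
  have hpdeg : p.degree < m := (Polynomial.degree_lt_iff_coeff_zero _ _).2 hpc0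
  have hpC : ∀ k : WithTop ℕ∞, ContDiff ℝ k (fun x => p.eval x) := by
    intro k
    simp only [hpe]
    fun_prop
  set g : ℝ → ℝ := fun x => f x - p.eval x with hg
  have hgC : ContDiff ℝ m g := hf.sub (hpC _)
  have hgd : ∀ j ≤ m, ∀ x, iteratedDeriv j g x =
      iteratedDeriv j f x - (Polynomial.derivative^[j] p).eval x := by
    intro j hj x
    have h := iteratedDeriv_fun_sub (n := j) (x := x) (f := f) (g := fun x => p.eval x)
      (hf.contDiffAt.of_le (by exact_mod_cast hj)) (hpC _).contDiffAt
    rw [p.iteratedDeriv_eval] at h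
    exact h
  have hR := abs_iteratedDeriv_le_of_vanishing hgC zero_le_one (B := B) (fun j hj => by
      rw [hgd j hj.le, ← Polynomial.coeff_zero_eq_eval_zero, Polynomial.coeff_iterate_derivative,
        zero_add, Nat.descFactorial_self, hpc j hj, hc, nsmul_eq_mul,
        mul_div_cancel₀ _ (by positivity), sub_self]) (fun x hx => by
      rw [hgd m le_rfl, Polynomial.iterate_derivative_eq_zero_of_degree_lt hpdeg]
      simpa using hB x hx)
  simp only [one_pow, mul_one] at hR
  set M := ∫ t in (0 : ℝ)..1, f t ^ 2 with hM
  have hM0 : 0 ≤ M := intervalIntegral.integral_nonneg zero_le_one fun _ _ => sq_nonneg _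
  have hint : ∫ t in (0 : ℝ)..1, (∑ i, c i * t ^ (i : ℕ)) ^ 2 ≤ 2 * M + 2 * B ^ 2 := by
    have hfc : Continuous f := hf.continuous
    have : ∫ t in (0 : ℝ)..1, (∑ i, c i * t ^ (i : ℕ)) ^ 2 ≤
        ∫ t in (0 : ℝ)..1, (2 * f t ^ 2 + 2 * B ^ 2) := by
      refine intervalIntegral.integral_mono_on zero_le_one
        (Continuous.intervalIntegrable (by fun_prop) _ _)
        (Continuous.intervalIntegrable (by fun_prop) _ _) fun x hx => ?_
      have h := hR m le_rfl x hx
      rw [Nat.sub_self, iteratedDeriv_zero, hg] at h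
      rw [← hpe]
      have h' := sq_le_sq' (abs_le.1 h).1 (abs_le.1 h).2
      nlinarith [sq_nonneg (f x + (f x - p.eval x))]
    refine this.trans_eq ?_
    rw [intervalIntegral.integral_add (Continuous.intervalIntegrable (by fun_prop) _ _)
        (Continuous.intervalIntegrable (by fun_prop) _ _), intervalIntegral.integral_const_mul]
    simp [hM]
  set S := K * (2 * M + 2 * B ^ 2) with hS
  have hS0 : 0 ≤ S := by rw [hS]; positivity
  have hco : ∀ j, |p.coeff j| ≤ √S := by
    intro j
    apply Real.abs_le_sqrt
    by_cases h : j < m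
    · rw [hpc j h]
      exact (hcoef c _).trans (mul_le_mul_of_nonneg_left hint hK.le)
    · rw [hpc0 j (by omega)]
      simpa using hS0
  have hpn : |(Polynomial.derivative^[n] p).eval t| ≤ D * √S := by
    have hdeg : (Polynomial.derivative^[n] p).natDegree < m + 1 := by
      have h1 := Polynomial.natDegree_iterate_derivative p n
      have h2 : p.natDegree ≤ m := Polynomial.natDegree_le_of_degree_le hpdeg.le
      omega
    rw [Polynomial.eval_eq_sum_range' hdeg, hD, Finset.sum_mul]
    refine (Finset.abs_sum_le_sum_abs _ _).trans (Finset.sum_le_sum fun i _ => ?_)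
    rw [Polynomial.coeff_iterate_derivative, nsmul_eq_mul, abs_mul, abs_mul, Nat.abs_cast,
      abs_of_nonneg (pow_nonneg ht.1 _)]
    calc _ ≤ ((i + n).descFactorial n : ℝ) * √S * 1 := by
          gcongr
          · exact pow_nonneg ht.1 _
          · exact hco _
          · exact pow_le_one₀ ht.1 ht.2
      _ = _ := mul_one _
  have hgn := hR (m - n) (by omega) t ht
  rw [Nat.sub_sub_self hnm, hgd n hnm] at hgn
  have h1 := sq_le_sq' (abs_le.1 hgn).1 (abs_le.1 hgn).2
  have h2 := sq_le_sq' (abs_le.1 hpn).1 (abs_le.1 hpn).2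
  rw [mul_pow, Real.sq_sqrt hS0] at h2
  have h3 : iteratedDeriv n f t ^ 2 ≤ 2 * B ^ 2 + 2 * (D ^ 2 * S) := by
    nlinarith [sq_nonneg (iteratedDeriv n f t - 2 * (Polynomial.derivative^[n] p).eval t)]
  rw [hS] at h3
  nlinarith

/-- Scale-invariant interpolation on `[a, a + l]`. -/
theorem exists_sq_iteratedDeriv_le {n m : ℕ} (hnm : n ≤ m) :
    ∃ K > (0 : ℝ), ∀ (f : ℝ → ℝ) (B a l : ℝ), 0 < l → ContDiff ℝ m f →
      (∀ t ∈ Set.Icc a (a + l), |iteratedDeriv m f t| ≤ B) →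
      ∀ t ∈ Set.Icc a (a + l), (l ^ n * iteratedDeriv n f t) ^ 2 ≤
        K * (l⁻¹ * (∫ t in a..a + l, f t ^ 2) + (l ^ m * B) ^ 2) := by
  obtain ⟨K, hK, h⟩ := exists_sq_iteratedDeriv_le_unit hnm
  refine ⟨K, hK, fun f B a l hl hf hB t ht => ?_⟩
  have hder : ∀ j ≤ m, ∀ s, iteratedDeriv j (fun s => f (a + l * s)) s =
      l ^ j * iteratedDeriv j f (a + l * s) := by
    intro j hj s
    have h1 : ContDiff ℝ j (fun x => f (a + x)) :=
      (hf.of_le (by exact_mod_cast hj)).comp (contDiff_const.add contDiff_id)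
    have h2 := congrFun (iteratedDeriv_comp_const_mul h1 l) s
    have h3 := congrFun (iteratedDeriv_comp_const_add j f a) (l * s)
    rw [h2, h3]
  have h1 := h (fun s => f (a + l * s)) (l ^ m * B)
    (hf.comp (contDiff_const.add (contDiff_const.mul contDiff_id))) (fun s hs => by
      rw [hder m le_rfl, abs_mul, abs_of_nonneg (by positivity)]
      exact mul_le_mul_of_nonneg_left (hB _ ⟨by nlinarith [hs.1], by nlinarith [hs.2]⟩)
        (by positivity)) ((t - a) / l)
    ⟨div_nonneg (by linarith [ht.1]) hl.le, (div_le_one hl).2 (by linarith [ht.2])⟩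
  rw [hder n hnm, mul_div_cancel₀ _ hl.ne', add_sub_cancel,
    intervalIntegral.integral_comp_add_mul (fun x => f x ^ 2) hl.ne'] at h1
  simpa using h1

/-- On an interval where `∫ f ^ 2` is comparable to `B ^ 2 * l ^ (6 * n + 1)`, interpolation bounds
the cubic integral by `(∫ f ^ 2) * B`. Bisecting at most `N` times until this happens gives the
general bound, up to an error that is geometrically small in `N`. -/
theorem integral_cube_le_of_bisection {n : ℕ} {K : ℝ} (hK : 0 < K) {f : ℝ → ℝ} {B L : ℝ}
    (hB0 : 0 ≤ B) (hfc : Continuous f) (hfn : Continuous (iteratedDeriv n f))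
    (hf : ∀ a l, 0 < l → 0 ≤ a → a + l ≤ L → ∀ t ∈ Set.Icc a (a + l),
      (l ^ n * iteratedDeriv n f t) ^ 2 ≤
        K * (l⁻¹ * (∫ t in a..a + l, f t ^ 2) + (l ^ (3 * n) * B) ^ 2)) (N : ℕ) :
    ∀ a l, 0 < l → 0 ≤ a → a + l ≤ L →
      (∫ t in a..a + l, f t ^ 2) ≤ 2 ^ (6 * n + 1) * (B ^ 2 * l ^ (6 * n + 1)) →
      (∫ t in a..a + l, |iteratedDeriv n f t| ^ 3) ≤ √(K * (2 ^ (6 * n + 1) + 1)) ^ 3 *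
        ((∫ t in a..a + l, f t ^ 2) * B + l ^ (6 * n + 1) * B ^ 3 * ((1 / 2) ^ (6 * n)) ^ N) := by
  set R := √(K * (2 ^ (6 * n + 1) + 1)) with hR
  have hRsq : R ^ 2 = K * (2 ^ (6 * n + 1) + 1) := Real.sq_sqrt (by positivity)
  have hnn : ∀ a l : ℝ, 0 < l → 0 ≤ ∫ t in a..a + l, f t ^ 2 := fun a l hl =>
    intervalIntegral.integral_nonneg (by linarith) fun _ _ => sq_nonneg _
  have direct : ∀ a l, 0 < l → 0 ≤ a → a + l ≤ L →
      (∫ t in a..a + l, f t ^ 2) ≤ 2 ^ (6 * n + 1) * (B ^ 2 * l ^ (6 * n + 1)) →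
      (∫ t in a..a + l, |iteratedDeriv n f t| ^ 3) ≤ R ^ 3 * (l ^ (6 * n + 1) * B ^ 3) := by
    intro a l hl ha hal hs
    have hb : ∀ t ∈ Set.Icc a (a + l), |iteratedDeriv n f t| ^ 3 ≤
        (R * (l ^ (2 * n) * B)) ^ 3 := by
      intro t ht
      gcongr
      have h1 := hf a l hl ha hal t ht
      have h2 : l⁻¹ * (∫ t in a..a + l, f t ^ 2) ≤
          l⁻¹ * (2 ^ (6 * n + 1) * (B ^ 2 * l ^ (6 * n + 1))) := by gcongr
      have h3 : l⁻¹ * (2 ^ (6 * n + 1) * (B ^ 2 * l ^ (6 * n + 1))) =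
          2 ^ (6 * n + 1) * (l ^ (3 * n) * B) ^ 2 := by
        field_simp
        ring
      have h4 : (l ^ n * iteratedDeriv n f t) ^ 2 ≤ (R * (l ^ (3 * n) * B)) ^ 2 := by
        rw [mul_pow R, hRsq]
        refine h1.trans ?_
        rw [mul_assoc]
        gcongr
        linarith
      have h5 := abs_le_of_sq_le_sq h4 (by positivity)
      rw [abs_mul, abs_of_pos (pow_pos hl n)] at h5
      refine le_of_mul_le_mul_left (h5.trans_eq ?_) (pow_pos hl n)
      ring
    calc (∫ t in a..a + l, |iteratedDeriv n f t| ^ 3)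
        ≤ ∫ t in a..a + l, (R * (l ^ (2 * n) * B)) ^ 3 :=
          intervalIntegral.integral_mono_on (by linarith)
            (Continuous.intervalIntegrable (by fun_prop) _ _)
            (Continuous.intervalIntegrable (by fun_prop) _ _) hb
      _ = _ := by
          rw [intervalIntegral.integral_const, smul_eq_mul]
          ring
  induction N with
  | zero =>
    intro a l hl ha hal hs
    refine (direct a l hl ha hal hs).trans ?_
    have := mul_nonneg (hnn a l hl) hB0
    rw [pow_zero, mul_one]
    gcongr
    linarith
  | succ N ih =>
    intro a l hl ha hal hs
    by_cases hbig : B ^ 2 * l ^ (6 * n + 1) ≤ ∫ t in a..a + l, f t ^ 2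
    · refine (direct a l hl ha hal hs).trans ?_
      gcongr
      have h1 := mul_le_mul_of_nonneg_right hbig hB0
      have h2 : 0 ≤ l ^ (6 * n + 1) * B ^ 3 * ((1 / 2) ^ (6 * n)) ^ (N + 1) := by positivity
      nlinarith
    · push Not at hbig
      have hsplit : ∀ g : ℝ → ℝ, Continuous g → ∫ t in a..a + l, g t =
          (∫ t in a..a + l / 2, g t) + ∫ t in a + l / 2..a + l / 2 + l / 2, g t := by
        intro g hg
        rw [intervalIntegral.integral_add_adjacent_intervals (hg.intervalIntegrable _ _)
          (hg.intervalIntegrable _ _)]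
        congr 1
        ring
      have hm := hsplit (fun t => f t ^ 2) (by fun_prop)
      have h1 := hnn a (l / 2) (by linarith)
      have h2 := hnn (a + l / 2) (l / 2) (by linarith)
      have hp : 2 ^ (6 * n + 1) * (B ^ 2 * (l / 2) ^ (6 * n + 1)) = B ^ 2 * l ^ (6 * n + 1) := by
        rw [div_pow]
        field_simp
      have i1 := ih a (l / 2) (by linarith) ha (by linarith) (by rw [hp]; linarith)
      have i2 := ih (a + l / 2) (l / 2) (by linarith) (by linarith) (by linarith)
        (by rw [hp]; linarith)
      rw [hsplit (fun t => |iteratedDeriv n f t| ^ 3) (by fun_prop), hm]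
      refine (add_le_add i1 i2).trans_eq ?_
      rw [div_pow l, pow_succ (2 : ℝ), pow_succ _ N]
      simp only [div_pow, one_pow]
      field_simp
      ring

theorem exists_gagliardo_nirenberg {n : ℕ} (hn : 1 ≤ n) :
    ∃ C₁ > (0 : ℝ), ∃ C₂ > (0 : ℝ), ∀ L > (0 : ℝ), ∀ f : ℝ → ℝ, ContDiff ℝ (3 * n : ℕ) f →
      ∀ B : ℝ, (∀ t ∈ Set.Icc 0 L, |iteratedDeriv (3 * n) f t| ≤ B) →
        (∫ t in (0 : ℝ)..L, |iteratedDeriv n f t| ^ 3) ≤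
          C₁ * (∫ t in (0 : ℝ)..L, f t ^ 2) * B +
          C₂ * L ^ (-(1 / 2 : ℝ) - 3 * n) * (∫ t in (0 : ℝ)..L, f t ^ 2) ^ (3 / 2 : ℝ) := by
  obtain ⟨K, hK, h⟩ := exists_sq_iteratedDeriv_le (show n ≤ 3 * n by omega)
  set R := √(K * (2 ^ (6 * n + 1) + 1)) with hR
  have hRpos : 0 < R := Real.sqrt_pos.2 (by positivity)
  refine ⟨R ^ 3, by positivity, (2 * K) ^ (3 / 2 : ℝ), by positivity, fun L hL f hf B hB => ?_⟩
  have hB0 : 0 ≤ B := (abs_nonneg _).trans (hB 0 ⟨le_rfl, hL.le⟩)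
  have hfc : Continuous f := hf.continuous
  have hfn : Continuous (iteratedDeriv n f) :=
    hf.continuous_iteratedDeriv _ (by norm_cast; omega)
  have hloc : ∀ a l, 0 < l → 0 ≤ a → a + l ≤ L → ∀ t ∈ Set.Icc a (a + l),
      (l ^ n * iteratedDeriv n f t) ^ 2 ≤
        K * (l⁻¹ * (∫ t in a..a + l, f t ^ 2) + (l ^ (3 * n) * B) ^ 2) :=
    fun a l hl ha hal => h f B a l hl hf fun t ht => hB t ⟨ha.trans ht.1, ht.2.trans hal⟩
  set M := ∫ t in (0 : ℝ)..L, f t ^ 2 with hM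
  have hM0 : 0 ≤ M := intervalIntegral.integral_nonneg hL.le fun _ _ => sq_nonneg _
  by_cases hbig : B ^ 2 * L ^ (6 * n + 1) ≤ M
  · refine le_add_of_nonneg_of_le (by positivity) ?_
    have hb : ∀ t ∈ Set.Icc 0 L, |iteratedDeriv n f t| ^ 3 ≤
        (2 * K * L ^ (-(2 * n + 1 : ℝ)) * M) ^ (3 / 2 : ℝ) := by
      intro t ht
      have h1 := hloc 0 L hL le_rfl (by simp) t (by simpa using ht)
      rw [zero_add, ← hM] at h1
      have h2 : (L ^ (3 * n) * B) ^ 2 ≤ L⁻¹ * M := by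
        rw [inv_mul_eq_div, le_div_iff₀ hL]
        refine le_trans (le_of_eq ?_) hbig
        ring
      have h3 : iteratedDeriv n f t ^ 2 ≤ 2 * K * L ^ (-(2 * n + 1 : ℝ)) * M := by
        have e : L ^ (-(2 * n + 1 : ℝ)) = (L ^ (2 * n + 1))⁻¹ := by
          rw [Real.rpow_neg hL.le, ← Real.rpow_natCast]
          push_cast
          rfl
        have h4 : (L ^ n * iteratedDeriv n f t) ^ 2 ≤ 2 * K * (L⁻¹ * M) := by nlinarith
        refine le_of_mul_le_mul_left (h4.trans_eq' ?_ |>.trans_eq ?_) (pow_pos hL (2 * n))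
        · ring
        · rw [e]
          field_simp
          ring
      calc |iteratedDeriv n f t| ^ 3 = (iteratedDeriv n f t ^ 2) ^ (3 / 2 : ℝ) := by
            rw [← sq_abs, ← Real.rpow_natCast, ← Real.rpow_natCast, ← Real.rpow_mul (abs_nonneg _)]
            norm_num
        _ ≤ _ := by gcongr
    calc (∫ t in (0 : ℝ)..L, |iteratedDeriv n f t| ^ 3)
        ≤ ∫ t in (0 : ℝ)..L, (2 * K * L ^ (-(2 * n + 1 : ℝ)) * M) ^ (3 / 2 : ℝ) :=
          intervalIntegral.integral_mono_on hL.le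
            (Continuous.intervalIntegrable (by fun_prop) _ _)
            (Continuous.intervalIntegrable (by fun_prop) _ _) hb
      _ = _ := by
          rw [intervalIntegral.integral_const, smul_eq_mul, sub_zero,
            Real.mul_rpow (by positivity) hM0, Real.mul_rpow (by positivity) (by positivity),
            ← Real.rpow_mul hL.le]
          have e : L ^ (-(1 / 2 : ℝ) - 3 * n) = L * L ^ (-(2 * n + 1 : ℝ) * (3 / 2)) := by
            rw [← Real.rpow_one_add' hL.le]
            · congr 1
              ring
            · have : (1 : ℝ) ≤ n := by exact_mod_cast hn
              nlinarith
          rw [e]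
          ring
  · push Not at hbig
    refine le_add_of_le_of_nonneg ?_ (by positivity)
    have hN := fun N => integral_cube_le_of_bisection hK hB0 hfc hfn hloc N 0 L hL le_rfl (by simp)
      (by
        rw [zero_add, ← hM]
        refine hbig.le.trans (le_mul_of_one_le_left (by positivity) (one_le_pow₀ one_le_two)))
    simp only [zero_add, ← hM, ← hR] at hN
    have hlim : Filter.Tendsto (fun N : ℕ => R ^ 3 *
        (M * B + L ^ (6 * n + 1) * B ^ 3 * ((1 / 2 : ℝ) ^ (6 * n)) ^ N)) Filter.atTop
        (nhds (R ^ 3 * (M * B + L ^ (6 * n + 1) * B ^ 3 * 0))) := by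
      refine ((Filter.Tendsto.const_mul _ ?_).const_add _).const_mul _
      exact tendsto_pow_atTop_nhds_zero_of_lt_one (by positivity)
        (pow_lt_one₀ (by norm_num) (by norm_num) (by omega))
    refine (ge_of_tendsto' hlim hN).trans_eq ?_
    ring

/-- If `f` vanishes to order `m` at `0`, the lower-order term is absorbed by the main term. -/
theorem rpow_mul_integral_sq_rpow_le_of_vanishing {m : ℕ} {f : ℝ → ℝ} (hf : ContDiff ℝ m f)
    {B L : ℝ} (hL : 0 < L) (h0 : ∀ j < m, iteratedDeriv j f 0 = 0)
    (hB : ∀ t ∈ Set.Icc 0 L, |iteratedDeriv m f t| ≤ B) :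
    L ^ (-(1 / 2 : ℝ) - m) * (∫ t in (0 : ℝ)..L, f t ^ 2) ^ (3 / 2 : ℝ) ≤
      (∫ t in (0 : ℝ)..L, f t ^ 2) * B := by
  have hB0 : 0 ≤ B := (abs_nonneg _).trans (hB 0 ⟨le_rfl, hL.le⟩)
  have hfc : Continuous f := hf.continuous
  have hpt := abs_iteratedDeriv_le_of_vanishing hf hL.le h0 hB m le_rfl
  rw [Nat.sub_self, iteratedDeriv_zero] at hpt
  set M := ∫ t in (0 : ℝ)..L, f t ^ 2 with hM
  have hM0 : 0 ≤ M := intervalIntegral.integral_nonneg hL.le fun _ _ => sq_nonneg _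
  have hle : M ≤ L * (B * L ^ m) ^ 2 := by
    calc M ≤ ∫ t in (0 : ℝ)..L, (B * L ^ m) ^ 2 :=
          intervalIntegral.integral_mono_on hL.le
            (Continuous.intervalIntegrable (by fun_prop) _ _)
            (Continuous.intervalIntegrable (by fun_prop) _ _)
            fun t ht => sq_le_sq' (abs_le.1 (hpt t ht)).1 (abs_le.1 (hpt t ht)).2
      _ = _ := by simp
  have hsqrt : M ^ (1 / 2 : ℝ) ≤ L ^ (1 / 2 + m : ℝ) * B := by
    calc M ^ (1 / 2 : ℝ) ≤ (L * (B * L ^ m) ^ 2) ^ (1 / 2 : ℝ) := by gcongr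
      _ = _ := by
        rw [← Real.sqrt_eq_rpow, Real.sqrt_mul hL.le, Real.sqrt_sq (by positivity),
          Real.rpow_add hL, Real.rpow_natCast, Real.sqrt_eq_rpow]
        ring
  have e : M ^ (3 / 2 : ℝ) = M * M ^ (1 / 2 : ℝ) := by
    rw [← Real.rpow_one_add' hM0 (by norm_num)]
    norm_num
  have e2 : L ^ (-(1 / 2 : ℝ) - m) * L ^ (1 / 2 + m : ℝ) = 1 := by
    rw [← Real.rpow_add hL]
    ring_nf
    simp
  calc _ ≤ L ^ (-(1 / 2 : ℝ) - m) * (M * (L ^ (1 / 2 + m : ℝ) * B)) := by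
        rw [e]; gcongr
    _ = (L ^ (-(1 / 2 : ℝ) - m) * L ^ (1 / 2 + m : ℝ)) * (M * B) := by ring
    _ = _ := by rw [e2, one_mul]

theorem integral_abs_cube_le {f : ℝ → ℝ} (hf : Continuous f) {B L : ℝ} (hL : 0 ≤ L)
    (hB : ∀ t ∈ Set.Icc 0 L, |f t| ≤ B) :
    (∫ t in (0 : ℝ)..L, |f t| ^ 3) ≤ (∫ t in (0 : ℝ)..L, f t ^ 2) * B := by
  rw [← intervalIntegral.integral_mul_const]
  refine intervalIntegral.integral_mono_on hL
    (Continuous.intervalIntegrable (by fun_prop) _ _)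
    (Continuous.intervalIntegrable (by fun_prop) _ _) fun t ht => ?_
  rw [pow_succ, sq_abs]
  exact mul_le_mul_of_nonneg_left (hB t ht) (sq_nonneg _)

/-- Gagliardo–Nirenberg interpolation: for every integer `κ ≥ 1` there are
`C₁, C₂ > 0` such that for every `L > 0` and `ψ ∈ W^{3κ−3,∞}((0,L),ℝ)`
(encoded as `ψ : ℝ → ℝ` of class `C^{3κ−3}`, with `B` any bound for
`|ψ^{(3κ−3)}|` on `[0,L]`):
`‖ψ^{(κ−1)}‖_{L³}³ ≤ C₁ ‖ψ‖_{L²}² B + C₂ L^{5/2−3κ} ‖ψ‖_{L²}³`, and if moreover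
`ψ(0) = ψ'(0) = … = ψ^{(3κ−4)}(0) = 0` then
`‖ψ^{(κ−1)}‖_{L³}³ ≤ (C₁ + C₂) ‖ψ‖_{L²}² B`. -/
theorem statement18 (κ : ℕ) (hκ : 1 ≤ κ) :
    ∃ C₁ > (0:ℝ), ∃ C₂ > (0:ℝ),
      (∀ L > (0:ℝ), ∀ ψ : ℝ → ℝ, ContDiff ℝ (3*κ - 3 : ℕ) ψ →
        ∀ B : ℝ, (∀ t ∈ Set.Icc (0:ℝ) L, |iteratedDeriv (3*κ - 3) ψ t| ≤ B) →
          (∫ t in (0:ℝ)..L, |iteratedDeriv (κ - 1) ψ t| ^ 3) ≤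
            C₁ * (∫ t in (0:ℝ)..L, (ψ t) ^ 2) * B +
            C₂ * L ^ ((5:ℝ)/2 - 3*(κ:ℝ)) *
              (∫ t in (0:ℝ)..L, (ψ t) ^ 2) ^ ((3:ℝ)/2)) ∧
      (∀ L > (0:ℝ), ∀ ψ : ℝ → ℝ, ContDiff ℝ (3*κ - 3 : ℕ) ψ →
        (∀ j : ℕ, j < 3*κ - 3 → iteratedDeriv j ψ 0 = 0) →
        ∀ B : ℝ, (∀ t ∈ Set.Icc (0:ℝ) L, |iteratedDeriv (3*κ - 3) ψ t| ≤ B) →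
          (∫ t in (0:ℝ)..L, |iteratedDeriv (κ - 1) ψ t| ^ 3) ≤
            (C₁ + C₂) * (∫ t in (0:ℝ)..L, (ψ t) ^ 2) * B) := by
  obtain ⟨n, rfl⟩ : ∃ n, κ = n + 1 := ⟨κ - 1, by omega⟩
  have e3 : 3 * (n + 1) - 3 = 3 * n := by omega
  have e1 : n + 1 - 1 = n := rfl
  have er : (5 : ℝ) / 2 - 3 * ((n + 1 : ℕ) : ℝ) = -(1 / 2 : ℝ) - 3 * n := by
    push_cast
    ring
  rw [e3, e1, er]
  obtain ⟨C₁, h₁, C₂, h₂, h⟩ : ∃ C₁ > (0 : ℝ), ∃ C₂ > (0 : ℝ), ∀ L > (0 : ℝ), ∀ f : ℝ → ℝ,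
      ContDiff ℝ (3 * n : ℕ) f →
      ∀ B : ℝ, (∀ t ∈ Set.Icc 0 L, |iteratedDeriv (3 * n) f t| ≤ B) →
        (∫ t in (0 : ℝ)..L, |iteratedDeriv n f t| ^ 3) ≤
          C₁ * (∫ t in (0 : ℝ)..L, f t ^ 2) * B +
          C₂ * L ^ (-(1 / 2 : ℝ) - 3 * n) * (∫ t in (0 : ℝ)..L, f t ^ 2) ^ (3 / 2 : ℝ) := by
    rcases Nat.eq_zero_or_pos n with rfl | hn
    · refine ⟨1, one_pos, 1, one_pos, fun L hL f hf B hB => ?_⟩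
      rw [mul_zero] at hB
      simp only [iteratedDeriv_zero, one_mul] at hB ⊢
      have hM0 : 0 ≤ ∫ t in (0 : ℝ)..L, f t ^ 2 :=
        intervalIntegral.integral_nonneg hL.le fun _ _ => sq_nonneg _
      exact le_add_of_le_of_nonneg (integral_abs_cube_le hf.continuous hL.le hB) (by positivity)
    · exact exists_gagliardo_nirenberg hn
  refine ⟨C₁, h₁, C₂, h₂, h, fun L hL f hf h0 B hB => (h L hL f hf B hB).trans ?_⟩
  have hv := rpow_mul_integral_sq_rpow_le_of_vanishing hf hL h0 hB
  push_cast at hv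
  rw [add_mul, add_mul]
  refine add_le_add le_rfl ?_
  rw [mul_assoc, mul_assoc]
  exact mul_le_mul_of_nonneg_left hv h₂.le
end
end
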